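/- arXiv:2207.04824 — 10 statements merged into one kernel-verified Lean document; each statement's English description precedes it below -/
import Mathlib

section
/- For every u ∈ dom(A) one has ⟨Au, u⟩ = ‖π₁u‖² − ‖π₋₁u‖², where the norms are taken in H. -/
/- Setting: `H` a real Hilbert space, `A₀` a closed, densely defined, skew-symmetric linear
operator with domain `domA₀`, and `A = -A₀*` characterised by `hA`.  A decomposition
`u = u₀ + v + w` with `u₀ ∈ dom A₀`, `v ∈ ker (1 - A)`, `w ∈ ker (1 + A)` exhibits
`v = π₁ u` and `w = π₋₁ u` (the decomposition is unique). -/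

open RealInnerProductSpace

/-- For every `u ∈ dom A`, `⟪A u, u⟫ = ‖π₁ u‖² - ‖π₋₁ u‖²`. -/
theorem stmt3 {H : Type*} [NormedAddCommGroup H] [InnerProductSpace ℝ H] [CompleteSpace H]
    (domA₀ : Submodule ℝ H) (A₀ : H →ₗ[ℝ] H)
    (hdense : Dense (domA₀ : Set H))
    (hskew : ∀ u ∈ domA₀, ∀ v ∈ domA₀, ⟪A₀ u, v⟫ = -⟪u, A₀ v⟫)
    (hclosed : IsClosed {p : H × H | p.1 ∈ domA₀ ∧ p.2 = A₀ p.1})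
    (domA : Submodule ℝ H) (A : H →ₗ[ℝ] H)
    (hA : ∀ v w : H, (v ∈ domA ∧ A v = w) ↔ ∀ u ∈ domA₀, ⟪A₀ u, v⟫ = -⟪u, w⟫)
    (u : H) (hu : u ∈ domA)
    (u₀ v w : H) (h₀ : u₀ ∈ domA₀) (hv : v ∈ domA) (hv1 : A v = v)
    (hw : w ∈ domA) (hw1 : A w = -w) (hdec : u = u₀ + v + w) :
    ⟪A u, u⟫ = ‖v‖ ^ 2 - ‖w‖ ^ 2 := by
  have hA₀ : A u₀ = A₀ u₀ := ((hA u₀ (A₀ u₀)).2 fun x hx => hskew x hx u₀ h₀).2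
  have h_zero : ⟪A₀ u₀, u₀⟫ = 0 := by
    have h := hskew u₀ h₀ u₀ h₀
    rw [real_inner_comm (A₀ u₀) u₀] at h
    linarith
  have h_v : ⟪A₀ u₀, v⟫ = -⟪u₀, v⟫ := (hA v v).1 ⟨hv, hv1⟩ u₀ h₀
  have h_w : ⟪A₀ u₀, w⟫ = -⟪u₀, -w⟫ := (hA w (-w)).1 ⟨hw, hw1⟩ u₀ h₀
  rw [hdec, map_add, map_add, hA₀, hv1, hw1]
  simp only [inner_add_left, inner_add_right, inner_neg_left, inner_neg_right,
    real_inner_self_eq_norm_sq] at h_w ⊢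
  rw [h_zero, h_v, h_w, real_inner_comm u₀ v, real_inner_comm u₀ w, real_inner_comm v w]
  ring
end

section
/- For every u ∈ dom(A): π₁u = ½ P_{ker(1−A)}(u + Au) and π₋₁u = ½ P_{ker(1+A)}(u − Au), where P_{ker(1−A)} and P_{ker(1+A)} denote the H-orthogonal projections of H onto the closed subspaces ker(1−A) and ker(1+A) respectively. -/
/- Setting: `H` a real Hilbert space, `A₀` a closed, densely defined, skew-symmetric linear
operator with domain `domA₀`, and `A = -A₀*` characterised by `hA`.  `P1` (resp. `Pm1`) is
the `H`-orthogonal projection onto the closed subspace `ker (1 - A)` (resp. `ker (1 + A)`),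
characterised by: `P1 x ∈ ker (1 - A)` and `x - P1 x ⊥ ker (1 - A)` for every `x ∈ H`.
A decomposition `u = u₀ + v + w` with `u₀ ∈ dom A₀`, `v ∈ ker (1 - A)`, `w ∈ ker (1 + A)`
exhibits `v = π₁ u` and `w = π₋₁ u` (the decomposition is unique). -/

open RealInnerProductSpace

/-- The foot of a perpendicular to a subspace is unique. -/
theorem Submodule.eq_of_forall_inner_sub_eq_zero {H : Type*} [NormedAddCommGroup H]
    [InnerProductSpace ℝ H] (K : Submodule ℝ H) {x p q : H} (hp : p ∈ K) (hq : q ∈ K)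
    (hxp : ∀ z ∈ K, ⟪x - p, z⟫ = 0) (hxq : ∀ z ∈ K, ⟪x - q, z⟫ = 0) : p = q := by
  have hmem : p - q ∈ K := K.sub_mem hp hq
  rw [← sub_eq_zero, ← inner_self_eq_zero (𝕜 := ℝ)]
  calc ⟪p - q, p - q⟫ = ⟪x - q, p - q⟫ - ⟪x - p, p - q⟫ := by
        rw [← inner_sub_left, sub_sub_sub_cancel_left]
    _ = 0 := by rw [hxp _ hmem, hxq _ hmem, sub_zero]

/-- For every `u ∈ dom A`:
`π₁ u = ½ P_{ker (1-A)} (u + A u)` and `π₋₁ u = ½ P_{ker (1+A)} (u - A u)`. -/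
theorem stmt4 {H : Type*} [NormedAddCommGroup H] [InnerProductSpace ℝ H] [CompleteSpace H]
    (domA₀ : Submodule ℝ H) (A₀ : H →ₗ[ℝ] H)
    (hdense : Dense (domA₀ : Set H))
    (hskew : ∀ u ∈ domA₀, ∀ v ∈ domA₀, ⟪A₀ u, v⟫ = -⟪u, A₀ v⟫)
    (hclosed : IsClosed {p : H × H | p.1 ∈ domA₀ ∧ p.2 = A₀ p.1})
    (domA : Submodule ℝ H) (A : H →ₗ[ℝ] H)
    (hA : ∀ v w : H, (v ∈ domA ∧ A v = w) ↔ ∀ u ∈ domA₀, ⟪A₀ u, v⟫ = -⟪u, w⟫)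
    (P1 Pm1 : H → H)
    (hP1 : ∀ x : H, (P1 x ∈ domA ∧ A (P1 x) = P1 x) ∧
      ∀ z, z ∈ domA → A z = z → ⟪x - P1 x, z⟫ = 0)
    (hPm1 : ∀ x : H, (Pm1 x ∈ domA ∧ A (Pm1 x) = -(Pm1 x)) ∧
      ∀ z, z ∈ domA → A z = -z → ⟪x - Pm1 x, z⟫ = 0)
    (u : H) (hu : u ∈ domA)
    (u₀ v w : H) (h₀ : u₀ ∈ domA₀) (hv : v ∈ domA) (hv1 : A v = v)
    (hw : w ∈ domA) (hw1 : A w = -w) (hdec : u = u₀ + v + w) :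
    v = (2 : ℝ)⁻¹ • P1 (u + A u) ∧ w = (2 : ℝ)⁻¹ • Pm1 (u - A u) := by
  have hAu₀ : A u₀ = A₀ u₀ := ((hA u₀ (A₀ u₀)).2 fun x hx => hskew x hx u₀ h₀).2
  have hadj (z : H) (hz : z ∈ domA) : ⟪A₀ u₀, z⟫ = -⟪u₀, A z⟫ := (hA z (A z)).1 ⟨hz, rfl⟩ u₀ h₀
  have hAu : A u = A₀ u₀ + v - w := by
    rw [hdec, map_add, map_add, hAu₀, hv1, hw1, sub_eq_add_neg]
  constructor
  · rw [eq_inv_smul_iff₀ two_ne_zero]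
    obtain ⟨hP, hPorth⟩ := hP1 (u + A u)
    refine (domA ⊓ LinearMap.eqLocus A LinearMap.id).eq_of_forall_inner_sub_eq_zero
      (x := u + A u) (Submodule.smul_mem _ _ ⟨hv, hv1⟩) hP (fun z hz => ?_)
      fun z hz => hPorth z hz.1 hz.2
    have hz1 : A z = z := hz.2
    have hsub : u + A u - (2 : ℝ) • v = u₀ + A₀ u₀ := by
      rw [hAu, hdec]; module
    rw [hsub, inner_add_left, hadj z hz.1, hz1, add_neg_cancel]
  · rw [eq_inv_smul_iff₀ two_ne_zero]
    obtain ⟨hP, hPorth⟩ := hPm1 (u - A u)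
    refine (domA ⊓ LinearMap.eqLocus A (-LinearMap.id)).eq_of_forall_inner_sub_eq_zero
      (x := u - A u) (Submodule.smul_mem _ _ ⟨hw, hw1⟩) hP (fun z hz => ?_)
      fun z hz => hPorth z hz.1 hz.2
    have hz1 : A z = -z := hz.2
    have hsub : u - A u - (2 : ℝ) • w = u₀ - A₀ u₀ := by
      rw [hAu, hdec]; module
    rw [hsub, inner_sub_left, hadj z hz.1, hz1, inner_neg_right, neg_neg, sub_self]
end

section
/- Let B ⊆ H × H be an accretive relation. Then B is m-accretive if and only if B is a closed subset of H × H and the range of 1 + B, namely {u + v : (u, v) ∈ B}, is dense in H. -/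
open RealInnerProductSpace

/-- A relation `B ⊆ H × H` is accretive if `⟪u - x, v - y⟫ ≥ 0` for all `(u, v), (x, y) ∈ B`. -/
def Accretive {H : Type*} [NormedAddCommGroup H] [InnerProductSpace ℝ H]
    (B : Set (H × H)) : Prop :=
  ∀ p ∈ B, ∀ q ∈ B, 0 ≤ ⟪p.1 - q.1, p.2 - q.2⟫

/-- A relation `B ⊆ H × H` is m-accretive if it is accretive and `1 + B` is onto. -/
def MAccretive {H : Type*} [NormedAddCommGroup H] [InnerProductSpace ℝ H]
    (B : Set (H × H)) : Prop :=
  Accretive B ∧ ∀ f : H, ∃ p ∈ B, p.1 + p.2 = f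

/-- On an accretive relation, the sum map `(u, v) ↦ u + v` does not decrease distances. -/
theorem Accretive.norm_sub_le {H : Type*} [NormedAddCommGroup H] [InnerProductSpace ℝ H]
    {B : Set (H × H)} (hB : Accretive B) {p q : H × H} (hp : p ∈ B) (hq : q ∈ B) :
    ‖p - q‖ ≤ ‖(p.1 + p.2) - (q.1 + q.2)‖ := by
  have h := hB p hp q hq
  have hsum : (p.1 + p.2) - (q.1 + q.2) = (p.1 - q.1) + (p.2 - q.2) := by abel
  have hsq := norm_add_sq_real (p.1 - q.1) (p.2 - q.2)
  rw [hsum, norm_prod_le_iff, Prod.fst_sub, Prod.snd_sub]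
  constructor <;> refine (sq_le_sq₀ (norm_nonneg _) (norm_nonneg _)).1 ?_ <;>
    nlinarith [sq_nonneg ‖p.1 - q.1‖, sq_nonneg ‖p.2 - q.2‖]

/-- An m-accretive relation is closed. -/
theorem MAccretive.isClosed {H : Type*} [NormedAddCommGroup H] [InnerProductSpace ℝ H]
    {B : Set (H × H)} (hB : MAccretive B) : IsClosed B := by
  refine isClosed_of_closure_subset fun p hp => ?_
  obtain ⟨q, hq, hqp⟩ := hB.2 (p.1 + p.2)
  have hclosed : IsClosed {r : H × H | ‖r - q‖ ≤ ‖(r.1 + r.2) - (q.1 + q.2)‖} :=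
    isClosed_le (by fun_prop) (by fun_prop)
  have h : ‖p - q‖ ≤ ‖(p.1 + p.2) - (q.1 + q.2)‖ :=
    closure_minimal (fun r hr => hB.1.norm_sub_le hr hq) hclosed hp
  rw [hqp, sub_self, norm_zero, norm_le_zero_iff, sub_eq_zero] at h
  exact h ▸ hq

/-- The range of `1 + B` is closed when `B` is a closed accretive relation. -/
theorem Accretive.isClosed_range_one_add {H : Type*} [NormedAddCommGroup H]
    [InnerProductSpace ℝ H] [CompleteSpace H] {B : Set (H × H)} (hB : Accretive B)
    (hc : IsClosed B) : IsClosed {f : H | ∃ p ∈ B, p.1 + p.2 = f} := by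
  have : CompleteSpace B := hc.completeSpace_coe
  have hanti : AntilipschitzWith 1 fun p : B => p.1.1 + p.1.2 := by
    refine AntilipschitzWith.of_le_mul_dist fun p q => ?_
    rw [Subtype.dist_eq, dist_eq_norm, dist_eq_norm, NNReal.coe_one, one_mul]
    exact hB.norm_sub_le p.2 q.2
  have hunif : UniformContinuous fun p : B => p.1.1 + p.1.2 :=
    (uniformContinuous_fst.comp uniformContinuous_subtype_val).add
      (uniformContinuous_snd.comp uniformContinuous_subtype_val)
  convert hanti.isClosed_range hunif using 1
  ext f
  simp

/-- An accretive relation `B ⊆ H × H` is m-accretive iff `B` is closed and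
`ran (1 + B) = {u + v : (u, v) ∈ B}` is dense in `H`. -/
theorem stmt5 {H : Type*} [NormedAddCommGroup H] [InnerProductSpace ℝ H] [CompleteSpace H]
    (B : Set (H × H)) (hB : Accretive B) :
    MAccretive B ↔ IsClosed B ∧ Dense {f : H | ∃ p ∈ B, p.1 + p.2 = f} := by
  constructor
  · intro h
    refine ⟨h.isClosed, fun f => subset_closure (h.2 f)⟩
  · rintro ⟨hc, hd⟩
    refine ⟨hB, fun f => ?_⟩
    exact (hB.isClosed_range_one_add hc).closure_subset (hd f)
end

section
/- Let h : ker(1−A) → ker(1+A) satisfy ‖h(x) − h(y)‖ ≤ ‖x − y‖ (norms in H) for all x, y ∈ ker(1−A), and let B := {(u, Au) : u ∈ dom(A), h(π₁u) = π₋₁u}. Then B is an m-accretive relation on H. -/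
/- Setting: `H` a real Hilbert space, `A₀` a closed, densely defined, skew-symmetric linear
operator with domain `domA₀`, and `A = -A₀*` characterised by `hA`.  The maps `πp`, `πm`
are the projections onto `ker (1 - A)` and `ker (1 + A)` coming from the (unique)
graph-orthogonal decomposition `dom A = dom A₀ ⊕_A ker (1 - A) ⊕_A ker (1 + A)`,
characterised by `hπ`. -/

open RealInnerProductSpace

section SkewSymmetric

variable {H : Type*} [NormedAddCommGroup H] [InnerProductSpace ℝ H]

/-- The range of `1 + A₀` is closed when `A₀` is closed and skew-symmetric. -/
lemma isClosed_map_id_add_of_skew [CompleteSpace H] (D : Submodule ℝ H) (A₀ : H →ₗ[ℝ] H)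
    (hskew : ∀ u ∈ D, ∀ v ∈ D, ⟪A₀ u, v⟫ = -⟪u, A₀ v⟫)
    (hclosed : IsClosed {p : H × H | p.1 ∈ D ∧ p.2 = A₀ p.1}) :
    IsClosed (D.map (LinearMap.id + A₀) : Set H) := by
  have : CompleteSpace {p : H × H | p.1 ∈ D ∧ p.2 = A₀ p.1} := hclosed.completeSpace_coe
  let F : {p : H × H | p.1 ∈ D ∧ p.2 = A₀ p.1} → H := fun p => p.1.1 + p.1.2
  have hanti : AntilipschitzWith 1 F := by
    refine AntilipschitzWith.of_le_mul_dist ?_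
    rintro ⟨⟨u, u'⟩, hu, hu'⟩ ⟨⟨v, v'⟩, hv, hv'⟩
    obtain rfl : u' = A₀ u := hu'
    obtain rfl : v' = A₀ v := hv'
    have hD := D.sub_mem hu hv
    have hzero : ⟪u - v, A₀ (u - v)⟫ = 0 := by
      have := hskew _ hD _ hD
      rw [real_inner_comm] at this
      linarith
    have hsq : ‖(u - v) + A₀ (u - v)‖ ^ 2 = ‖u - v‖ ^ 2 + ‖A₀ (u - v)‖ ^ 2 := by
      rw [norm_add_sq_real, hzero]
      ring
    have hF : F ⟨(u, A₀ u), hu, rfl⟩ - F ⟨(v, A₀ v), hv, rfl⟩ = (u - v) + A₀ (u - v) := by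
      simp only [F, map_sub]
      abel
    rw [Subtype.dist_eq, Prod.dist_eq, dist_eq_norm, dist_eq_norm, dist_eq_norm, hF,
      ← map_sub, NNReal.coe_one, one_mul]
    refine max_le ?_ ?_ <;>
    · refine le_of_sq_le_sq ?_ (norm_nonneg _)
      nlinarith [sq_nonneg ‖u - v‖, sq_nonneg ‖A₀ (u - v)‖]
  have huc : UniformContinuous F :=
    uniformContinuous_add.comp uniformContinuous_subtype_val
  convert hanti.isClosed_range huc using 1
  ext y
  simp only [SetLike.mem_coe, Submodule.mem_map, Set.mem_range]
  constructor
  · rintro ⟨u, hu, rfl⟩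
    exact ⟨⟨(u, A₀ u), hu, rfl⟩, rfl⟩
  · rintro ⟨⟨⟨u, u'⟩, hu, hu'⟩, rfl⟩
    obtain rfl : u' = A₀ u := hu'
    exact ⟨u, hu, rfl⟩

/-- The boundary form of a vector `z + a + b` with `z ∈ dom A₀`, `a ∈ ker (1 - A)` and
`b ∈ ker (1 + A)`; here `w = A₀ z`. -/
lemma inner_boundary_form {z w a b : H} (hz : ⟪w, z⟫ = -⟪z, w⟫) (ha : ⟪w, a⟫ = -⟪z, a⟫)
    (hb : ⟪w, b⟫ = ⟪z, b⟫) : ⟪z + a + b, w + a - b⟫ = ‖a‖ ^ 2 - ‖b‖ ^ 2 := by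
  simp only [inner_add_left, inner_add_right, inner_sub_right, real_inner_self_eq_norm_sq,
    real_inner_comm w a, real_inner_comm w b, real_inner_comm a b, ha, hb]
  rw [real_inner_comm] at hz
  linarith

/-- The sum of `dom A₀`, `ker (1 - A)` and `ker (1 + A)` is direct; here `w = A₀ z`. -/
lemma eq_zero_of_decomposition {z w a b : H} (ha : ⟪w, a⟫ = -⟪z, a⟫) (hb : ⟪w, b⟫ = ⟪z, b⟫)
    (hsum : z + a + b = 0) (hA : w + a - b = 0) : a = 0 ∧ b = 0 := by
  have hz : z = -a - b := by
    rw [← sub_eq_zero, ← hsum]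
    abel
  have hw : w = b - a := by
    rw [← sub_eq_zero, ← hA]
    abel
  subst hz hw
  simp only [inner_sub_left, inner_neg_left, real_inner_comm a b] at ha hb
  constructor
  · refine (inner_self_eq_zero (𝕜 := ℝ)).1 ?_
    linarith
  · refine (inner_self_eq_zero (𝕜 := ℝ)).1 ?_
    linarith

end SkewSymmetric

/-- If `h : ker (1 - A) → ker (1 + A)` is a contraction
(`‖h x - h y‖ ≤ ‖x - y‖` in `H`), then `B = {(u, A u) : u ∈ dom A, h (π₁ u) = π₋₁ u}`
is m-accretive. -/
theorem stmt6 {H : Type*} [NormedAddCommGroup H] [InnerProductSpace ℝ H] [CompleteSpace H]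
    (domA₀ : Submodule ℝ H) (A₀ : H →ₗ[ℝ] H)
    (hdense : Dense (domA₀ : Set H))
    (hskew : ∀ u ∈ domA₀, ∀ v ∈ domA₀, ⟪A₀ u, v⟫ = -⟪u, A₀ v⟫)
    (hclosed : IsClosed {p : H × H | p.1 ∈ domA₀ ∧ p.2 = A₀ p.1})
    (domA : Submodule ℝ H) (A : H →ₗ[ℝ] H)
    (hA : ∀ v w : H, (v ∈ domA ∧ A v = w) ↔ ∀ u ∈ domA₀, ⟪A₀ u, v⟫ = -⟪u, w⟫)
    (πp πm : H → H)
    (hπ : ∀ u ∈ domA, (u - πp u - πm u) ∈ domA₀ ∧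
      (πp u ∈ domA ∧ A (πp u) = πp u) ∧ (πm u ∈ domA ∧ A (πm u) = -(πm u)))
    (h : H → H)
    (hmap : ∀ x ∈ domA, A x = x → h x ∈ domA ∧ A (h x) = -(h x))
    (hcon : ∀ x ∈ domA, ∀ y ∈ domA, A x = x → A y = y → ‖h x - h y‖ ≤ ‖x - y‖) :
    MAccretive {p : H × H | p.1 ∈ domA ∧ h (πp p.1) = πm p.1 ∧ p.2 = A p.1} := by
  have hext : ∀ u ∈ domA₀, u ∈ domA ∧ A u = A₀ u := fun u hu =>
    (hA _ _).2 fun v hv => hskew v hv u hu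
  have hpos : ∀ a ∈ domA, A a = a → ∀ z ∈ domA₀, ⟪A₀ z, a⟫ = -⟪z, a⟫ :=
    fun a ha ha' z hz => (hA a a).1 ⟨ha, ha'⟩ z hz
  have hneg : ∀ b ∈ domA, A b = -b → ∀ z ∈ domA₀, ⟪A₀ z, b⟫ = ⟪z, b⟫ := by
    intro b hb hb' z hz
    simpa using (hA b (-b)).1 ⟨hb, hb'⟩ z hz
  constructor
  · rintro ⟨u, v⟩ ⟨hu, hhu, hv⟩ ⟨x, y⟩ ⟨hx, hhx, hy⟩
    dsimp only at hu hhu hv hx hhx hy ⊢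
    subst hv hy
    obtain ⟨hu0, ⟨hup, hup'⟩, hum, hum'⟩ := hπ u hu
    obtain ⟨hx0, ⟨hxp, hxp'⟩, hxm, hxm'⟩ := hπ x hx
    have hz := domA₀.sub_mem hu0 hx0
    have ha := domA.sub_mem hup hxp
    have hb := domA.sub_mem hum hxm
    have ha' : A (πp u - πp x) = πp u - πp x := by rw [map_sub, hup', hxp']
    have hb' : A (πm u - πm x) = -(πm u - πm x) := by
      rw [map_sub, hum', hxm']
      abel
    have hform := inner_boundary_form (hskew _ hz _ hz) (hpos _ ha ha' _ hz) (hneg _ hb hb' _ hz)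
    have hux : (u - πp u - πm u - (x - πp x - πm x)) + (πp u - πp x) + (πm u - πm x) = u - x := by
      abel
    have hAux : A₀ (u - πp u - πm u - (x - πp x - πm x)) + (πp u - πp x) - (πm u - πm x)
        = A u - A x := by
      rw [← map_sub, ← hux, map_add, map_add, (hext _ hz).2, ha', hb', sub_eq_add_neg]
    rw [hux, hAux] at hform
    have hle := hcon _ hup _ hxp hup' hxp'
    rw [hhu, hhx] at hle
    rw [hform, sub_nonneg]
    gcongr
  · intro f
    have : CompleteSpace (domA₀.map (LinearMap.id + A₀)) :=
      (isClosed_map_id_add_of_skew domA₀ A₀ hskew hclosed).completeSpace_coe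
    obtain ⟨y, hy, w, hw, rfl⟩ :=
      (domA₀.map (LinearMap.id + A₀)).exists_add_mem_mem_orthogonal f
    obtain ⟨z, hz, rfl⟩ := Submodule.mem_map.1 hy
    obtain ⟨hwA, hw'⟩ : w ∈ domA ∧ A w = w := by
      refine (hA w w).2 fun v hv => ?_
      have := (Submodule.mem_orthogonal _ _).1 hw _ (Submodule.mem_map_of_mem hv)
      rw [LinearMap.add_apply, LinearMap.id_apply, inner_add_left] at this
      linarith
    obtain ⟨a, rfl⟩ : ∃ a, w = (2 : ℝ) • a := ⟨(2 : ℝ)⁻¹ • w, by simp⟩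
    have ha : a ∈ domA := by simpa using domA.smul_mem (2 : ℝ)⁻¹ hwA
    have ha' : A a = a := by simpa using hw'
    obtain ⟨hb, hb'⟩ := hmap a ha ha'
    have hu : z + a + h a ∈ domA := domA.add_mem (domA.add_mem (hext z hz).1 ha) hb
    have hAu : A (z + a + h a) = A₀ z + a - h a := by
      rw [map_add, map_add, (hext z hz).2, ha', hb', sub_eq_add_neg]
    refine ⟨(z + a + h a, A (z + a + h a)), ⟨hu, ?_, rfl⟩, ?_⟩
    · set u := z + a + h a with hu_def
      obtain ⟨hu0, ⟨hup, hup'⟩, hum, hum'⟩ := hπ u hu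
      have hz' := domA₀.sub_mem hu0 hz
      have hda := domA.sub_mem hup ha
      have hdb := domA.sub_mem hum hb
      have hda' : A (πp u - a) = πp u - a := by rw [map_sub, hup', ha']
      have hdb' : A (πm u - h a) = -(πm u - h a) := by
        rw [map_sub, hum', hb']
        abel
      have hsum : (u - πp u - πm u - z) + (πp u - a) + (πm u - h a) = 0 := by
        rw [hu_def]
        abel
      obtain ⟨hp, hm⟩ := eq_zero_of_decomposition (hpos _ hda hda' _ hz') (hneg _ hdb hdb' _ hz')
        hsum (by
          rw [← map_zero A, ← hsum, map_add, map_add, (hext _ hz').2, hda', hdb', sub_eq_add_neg])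
      rw [sub_eq_zero.1 hp, sub_eq_zero.1 hm]
    · dsimp only
      rw [hAu, LinearMap.add_apply, LinearMap.id_apply, two_smul]
      abel
end

section
/- Let B = {(u, Au) : u ∈ D} be a restriction of A to a subset D ⊆ dom(A). Then B is m-accretive if and only if there exists a mapping h : ker(1−A) → ker(1+A) with ‖h(x) − h(y)‖ ≤ ‖x − y‖ (norms in H) for all x, y ∈ ker(1−A) such that D = {u ∈ dom(A) : h(π₁u) = π₋₁u}. -/
/- Setting: `H` a real Hilbert space, `A₀` a closed, densely defined, skew-symmetric linear
operator with domain `domA₀`, and `A = -A₀*` characterised by `hA`.  The maps `πp`, `πm`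
are the projections onto `ker (1 - A)` and `ker (1 + A)` coming from the (unique)
graph-orthogonal decomposition `dom A = dom A₀ ⊕_A ker (1 - A) ⊕_A ker (1 + A)`,
characterised by `hπ`.  `B` is the restriction of `A` to `Dset ⊆ dom A`. -/

open RealInnerProductSpace

/-- If `A` is a formal extension of the skew-symmetric operator `A₀` on `domA₀`, then `1 + A` is
injective on `domA₀`, and its range there is orthogonal to `ker (1 - A)`. -/
theorem eq_zero_of_add_apply_add_two_smul_eq_zero {H : Type*} [NormedAddCommGroup H]
    [InnerProductSpace ℝ H] {domA₀ domA : Submodule ℝ H} {A : H →ₗ[ℝ] H}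
    (hle : domA₀ ≤ domA) (hskew : ∀ u ∈ domA₀, ∀ v ∈ domA, ⟪A u, v⟫ = -⟪u, A v⟫)
    {u p : H} (hu : u ∈ domA₀) (hp : p ∈ domA) (hAp : A p = p)
    (h : u + A u + (2 : ℝ) • p = 0) : u = 0 ∧ p = 0 := by
  have hp0 : p = 0 := by
    have h1 : ⟪u + A u + (2 : ℝ) • p, p⟫ = 0 := by rw [h, inner_zero_left]
    rw [inner_add_left, inner_add_left, real_inner_smul_left, hskew u hu p hp, hAp] at h1
    exact inner_self_eq_zero (𝕜 := ℝ).mp (by linarith)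
  subst hp0
  refine ⟨?_, rfl⟩
  have h1 : ⟪u + A u, u⟫ = 0 := by
    rw [smul_zero, add_zero] at h
    rw [h, inner_zero_left]
  have h2 := hskew u hu u (hle hu)
  rw [real_inner_comm (A u) u] at h2
  rw [inner_add_left] at h1
  exact inner_self_eq_zero (𝕜 := ℝ).mp (by linarith)

/-- The quadratic form of `A` is the difference of the squared norms of the components in
`ker (1 - A)` and `ker (1 + A)`. -/
theorem inner_apply_eq_norm_sq_sub_norm_sq {H : Type*} [NormedAddCommGroup H]
    [InnerProductSpace ℝ H] {domA₀ domA : Submodule ℝ H} {A : H →ₗ[ℝ] H}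
    (hle : domA₀ ≤ domA) (hskew : ∀ u ∈ domA₀, ∀ v ∈ domA, ⟪A u, v⟫ = -⟪u, A v⟫)
    {u p m : H} (hu : u - p - m ∈ domA₀) (hp : p ∈ domA) (hAp : A p = p) (hm : m ∈ domA)
    (hAm : A m = -m) : ⟪u, A u⟫ = ‖p‖ ^ 2 - ‖m‖ ^ 2 := by
  obtain ⟨w, rfl⟩ : ∃ w, u = w + p + m := ⟨u - p - m, by abel⟩
  have hw : w ∈ domA₀ := by
    rwa [add_assoc, sub_sub, add_sub_cancel_right] at hu
  have h1 := hskew w hw w (hle hw)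
  have h2 := hskew w hw p hp
  have h3 := hskew w hw m hm
  rw [real_inner_comm] at h1 h2 h3
  rw [hAp] at h2
  rw [hAm, inner_neg_right] at h3
  simp only [map_add, hAp, hAm, inner_add_left, inner_add_right, inner_neg_right,
    real_inner_self_eq_norm_sq, real_inner_comm p m]
  linarith

/-- The range of `1 + A₀` is closed if `A₀` is closed and skew-symmetric. -/
theorem isClosed_map_id_add {H : Type*} [NormedAddCommGroup H] [InnerProductSpace ℝ H]
    [CompleteSpace H] {domA₀ : Submodule ℝ H} {A₀ : H →ₗ[ℝ] H}
    (hskew : ∀ u ∈ domA₀, ∀ v ∈ domA₀, ⟪A₀ u, v⟫ = -⟪u, A₀ v⟫)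
    (hclosed : IsClosed {p : H × H | p.1 ∈ domA₀ ∧ p.2 = A₀ p.1}) :
    IsClosed (domA₀.map (LinearMap.id + A₀) : Set H) := by
  let G : Set (H × H) := {p : H × H | p.1 ∈ domA₀ ∧ p.2 = A₀ p.1}
  have : CompleteSpace G := hclosed.completeSpace_coe
  let f : G → H := fun p => p.1.1 + p.1.2
  have huc : UniformContinuous f :=
    (uniformContinuous_fst.comp uniformContinuous_subtype_val).add
      (uniformContinuous_snd.comp uniformContinuous_subtype_val)
  have hf : AntilipschitzWith 1 f := by
    refine AntilipschitzWith.of_le_mul_dist fun ⟨⟨u, a⟩, hu, ha⟩ ⟨⟨v, b⟩, hv, hb⟩ => ?_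
    simp only at hu ha hv hb
    subst ha hb
    have hw := domA₀.sub_mem hu hv
    have h1 := hskew _ hw _ hw
    rw [real_inner_comm] at h1
    have h2 := norm_add_sq_real (u - v) (A₀ (u - v))
    have h3 : ⟪u - v, A₀ (u - v)⟫ = 0 := by linarith
    rw [h3] at h2
    have hd : dist (f ⟨(u, A₀ u), hu, rfl⟩) (f ⟨(v, A₀ v), hv, rfl⟩) =
        ‖(u - v) + A₀ (u - v)‖ := by
      rw [dist_eq_norm, map_sub]
      congr 1
      simp only [f]
      abel
    rw [hd, NNReal.coe_one, one_mul, Subtype.dist_eq, Prod.dist_eq, dist_eq_norm, dist_eq_norm,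
      ← map_sub]
    refine max_le ?_ ?_ <;> refine le_of_sq_le_sq ?_ (norm_nonneg _)
    · nlinarith [sq_nonneg ‖A₀ (u - v)‖]
    · nlinarith [sq_nonneg ‖u - v‖]
  convert hf.isClosed_range huc using 1
  ext y
  constructor
  · rintro ⟨u, hu, rfl⟩
    exact ⟨⟨(u, A₀ u), hu, rfl⟩, rfl⟩
  · rintro ⟨⟨⟨u, a⟩, hu, ha⟩, rfl⟩
    exact ⟨u, hu, by simp only at ha; subst ha; rfl⟩

/-- `H` is the sum of the range of `1 + A₀` and `ker (1 - A)`, where `A = -A₀*`. -/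
theorem exists_add_apply_add_two_smul_eq {H : Type*} [NormedAddCommGroup H]
    [InnerProductSpace ℝ H] [CompleteSpace H] {domA₀ domA : Submodule ℝ H} {A₀ A : H →ₗ[ℝ] H}
    (hskew : ∀ u ∈ domA₀, ∀ v ∈ domA₀, ⟪A₀ u, v⟫ = -⟪u, A₀ v⟫)
    (hclosed : IsClosed {p : H × H | p.1 ∈ domA₀ ∧ p.2 = A₀ p.1})
    (hA : ∀ v w : H, (v ∈ domA ∧ A v = w) ↔ ∀ u ∈ domA₀, ⟪A₀ u, v⟫ = -⟪u, w⟫) (f : H) :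
    ∃ u ∈ domA₀, ∃ p ∈ domA, A p = p ∧ u + A₀ u + (2 : ℝ) • p = f := by
  let R := domA₀.map (LinearMap.id + A₀)
  have : CompleteSpace R := (isClosed_map_id_add hskew hclosed).completeSpace_coe
  obtain ⟨r, hr, q, hq, rfl⟩ := R.exists_add_mem_mem_orthogonal f
  obtain ⟨u, hu, rfl⟩ := hr
  have hp := Rᗮ.smul_mem (1 / 2 : ℝ) hq
  obtain ⟨hp1, hp2⟩ := (hA ((1 / 2 : ℝ) • q) ((1 / 2 : ℝ) • q)).mpr fun v hv => by
    have h := (Submodule.mem_orthogonal R _).mp hp _ ⟨v, hv, rfl⟩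
    rw [LinearMap.add_apply, LinearMap.id_apply, inner_add_left] at h
    linarith
  exact ⟨u, hu, _, hp1, hp2, by simp [smul_smul]⟩

/-- main theorem. A restriction `B = {(u, A u) : u ∈ Dset}` of `A` is
m-accretive iff there is a contraction `h : ker (1 - A) → ker (1 + A)` such that
`Dset = {u ∈ dom A : h (π₁ u) = π₋₁ u}`. -/
theorem stmt7 {H : Type*} [NormedAddCommGroup H] [InnerProductSpace ℝ H] [CompleteSpace H]
    (domA₀ : Submodule ℝ H) (A₀ : H →ₗ[ℝ] H)
    (hdense : Dense (domA₀ : Set H))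
    (hskew : ∀ u ∈ domA₀, ∀ v ∈ domA₀, ⟪A₀ u, v⟫ = -⟪u, A₀ v⟫)
    (hclosed : IsClosed {p : H × H | p.1 ∈ domA₀ ∧ p.2 = A₀ p.1})
    (domA : Submodule ℝ H) (A : H →ₗ[ℝ] H)
    (hA : ∀ v w : H, (v ∈ domA ∧ A v = w) ↔ ∀ u ∈ domA₀, ⟪A₀ u, v⟫ = -⟪u, w⟫)
    (πp πm : H → H)
    (hπ : ∀ u ∈ domA, (u - πp u - πm u) ∈ domA₀ ∧
      (πp u ∈ domA ∧ A (πp u) = πp u) ∧ (πm u ∈ domA ∧ A (πm u) = -(πm u)))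
    (Dset : Set H) (hDsub : Dset ⊆ (domA : Set H)) :
    MAccretive {p : H × H | p.1 ∈ Dset ∧ p.2 = A p.1} ↔
      ∃ h : H → H,
        (∀ x ∈ domA, A x = x → h x ∈ domA ∧ A (h x) = -(h x)) ∧
        (∀ x ∈ domA, ∀ y ∈ domA, A x = x → A y = y → ‖h x - h y‖ ≤ ‖x - y‖) ∧
        Dset = {u : H | u ∈ domA ∧ h (πp u) = πm u} := by
  have hext : ∀ u ∈ domA₀, u ∈ domA ∧ A u = A₀ u := fun u hu =>
    (hA u (A₀ u)).mpr fun v hv => hskew v hv u hu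
  have hle : domA₀ ≤ domA := fun u hu => (hext u hu).1
  have hskewA : ∀ u ∈ domA₀, ∀ v ∈ domA, ⟪A u, v⟫ = -⟪u, A v⟫ := fun u hu v hv => by
    rw [(hext u hu).2]
    exact (hA v (A v)).mp ⟨hv, rfl⟩ u hu
  have hadd : ∀ u ∈ domA, u + A u = (u - πp u - πm u) + A (u - πp u - πm u) + (2 : ℝ) • πp u := by
    intro u hu
    rw [map_sub, map_sub, (hπ u hu).2.1.2, (hπ u hu).2.2.2, two_smul]
    abel
  have hquad : ∀ u ∈ domA, ∀ x ∈ domA,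
      ⟪u - x, A u - A x⟫ = ‖πp u - πp x‖ ^ 2 - ‖πm u - πm x‖ ^ 2 := by
    intro u hu x hx
    obtain ⟨hu0, ⟨hup, hup'⟩, hum, hum'⟩ := hπ u hu
    obtain ⟨hx0, ⟨hxp, hxp'⟩, hxm, hxm'⟩ := hπ x hx
    rw [← map_sub]
    refine inner_apply_eq_norm_sq_sub_norm_sq hle hskewA ?_ (domA.sub_mem hup hxp)
      (by rw [map_sub, hup', hxp']) (domA.sub_mem hum hxm) (by rw [map_sub, hum', hxm']; abel)
    convert domA₀.sub_mem hu0 hx0 using 1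
    abel
  have huniq : ∀ u ∈ domA, ∀ w ∈ domA₀, ∀ p ∈ domA, A p = p →
      u + A u = w + A w + (2 : ℝ) • p → u - πp u - πm u = w ∧ πp u = p := by
    intro u hu w hw p hp hAp h
    obtain ⟨hu0, ⟨hup, hup'⟩, -⟩ := hπ u hu
    have := eq_zero_of_add_apply_add_two_smul_eq_zero hle hskewA (domA₀.sub_mem hu0 hw)
      (domA.sub_mem hup hp) (by rw [map_sub, hup', hAp]) (by
        rw [hadd u hu] at h
        rw [map_sub A _ w, smul_sub]
        rw [← sub_eq_zero] at h
        rw [← h]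
        abel)
    exact ⟨sub_eq_zero.mp this.1, sub_eq_zero.mp this.2⟩
  constructor
  · rintro ⟨hacc, hsurj⟩
    have hcontr : ∀ u ∈ Dset, ∀ x ∈ Dset, ‖πm u - πm x‖ ≤ ‖πp u - πp x‖ := by
      intro u hu x hx
      have h := hacc (u, A u) ⟨hu, rfl⟩ (x, A x) ⟨hx, rfl⟩
      rw [hquad u (hDsub hu) x (hDsub hx)] at h
      exact le_of_sq_le_sq (by linarith) (norm_nonneg _)
    have hsolve : ∀ f : H, ∃ u ∈ Dset, u + A u = f := by
      intro f
      obtain ⟨⟨u, a⟩, ⟨hu, ha⟩, h⟩ := hsurj f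
      exact ⟨u, hu, by simp only at ha h; rwa [← ha]⟩
    choose S hSD hS using hsolve
    have hSp : ∀ p ∈ domA, A p = p → πp (S ((2 : ℝ) • p)) = p := fun p hp hAp =>
      (huniq _ (hDsub (hSD _)) 0 domA₀.zero_mem p hp hAp (by rw [hS]; simp)).2
    refine ⟨fun p => πm (S ((2 : ℝ) • p)), fun p _ _ => (hπ _ (hDsub (hSD _))).2.2, ?_, ?_⟩
    · intro x hx y hy hAx hAy
      simpa only [hSp x hx hAx, hSp y hy hAy] using
        hcontr _ (hSD ((2 : ℝ) • x)) _ (hSD ((2 : ℝ) • y))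
    · have hgraph : ∀ u ∈ Dset, πm (S ((2 : ℝ) • πp u)) = πm u := by
        intro u hu
        have hup := (hπ u (hDsub hu)).2.1
        have h := hcontr _ (hSD ((2 : ℝ) • πp u)) u hu
        rw [hSp _ hup.1 hup.2, sub_self, norm_zero] at h
        exact sub_eq_zero.mp (norm_le_zero_iff.mp h)
      ext u
      refine ⟨fun hu => ⟨hDsub hu, hgraph u hu⟩, fun ⟨hu, hum⟩ => ?_⟩
      have hx := hSD (u + A u)
      obtain ⟨hu0, ⟨hup, hup'⟩, -⟩ := hπ u hu
      obtain ⟨h0, hp⟩ := huniq _ (hDsub hx) _ hu0 _ hup hup' ((hS _).trans (hadd u hu))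
      have hm := hgraph _ hx
      rw [hp] at hm
      rw [hp, ← hm, show πm (S ((2 : ℝ) • πp u)) = πm u from hum] at h0
      have : S (u + A u) = u := by simpa using h0
      rwa [this] at hx
  · rintro ⟨h, hker, hcontr, rfl⟩
    refine ⟨?_, fun f => ?_⟩
    · rintro ⟨u, a⟩ ⟨⟨hu, hum⟩, ha⟩ ⟨x, b⟩ ⟨⟨hx, hxm⟩, hb⟩
      simp only at hu hum ha hx hxm hb ⊢
      subst ha hb
      rw [hquad u hu x hx, ← hum, ← hxm, sub_nonneg]
      obtain ⟨-, ⟨hup, hup'⟩, -⟩ := hπ u hu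
      obtain ⟨-, ⟨hxp, hxp'⟩, -⟩ := hπ x hx
      exact pow_le_pow_left₀ (norm_nonneg _) (hcontr _ hup _ hxp hup' hxp') 2
    · obtain ⟨w, hw, p, hp, hAp, rfl⟩ := exists_add_apply_add_two_smul_eq hskew hclosed hA f
      obtain ⟨hm, hAm⟩ := hker p hp hAp
      have hu : w + p + h p ∈ domA := domA.add_mem (domA.add_mem (hle hw) hp) hm
      have hsum : w + p + h p + A (w + p + h p) = w + A w + (2 : ℝ) • p := by
        rw [map_add, map_add, hAp, hAm, two_smul]
        abel
      obtain ⟨h0, hpu⟩ := huniq _ hu w hw p hp hAp hsum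
      refine ⟨(w + p + h p, A (w + p + h p)), ⟨⟨hu, ?_⟩, rfl⟩, ?_⟩
      · rw [hpu] at h0 ⊢
        have h1 : h p - πm (w + p + h p) = 0 := by
          rw [← sub_eq_zero] at h0
          rw [← h0]
          abel
        exact sub_eq_zero.mp h1
      · simp only [hsum, (hext w hw).2]
end

section
/- Let B = {(u, Au) : u ∈ dom(B)} be an m-accretive restriction of A and h : ker(1−A) → ker(1+A) a contraction with dom(B) = {u ∈ dom(A) : h(π₁u) = π₋₁u}. Then for every v ∈ ker(1−A) there exists a unique u ∈ dom(B) with u + Au = 2v, and h(v) = π₋₁u = ½ P_{ker(1+A)}(u − Au), where P_{ker(1+A)} is the H-orthogonal projection onto ker(1+A). In particular, h is uniquely determined by B. -/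
/- Setting: `H` a real Hilbert space, `A₀` a closed, densely defined, skew-symmetric linear
operator with domain `domA₀`, and `A = -A₀*` characterised by `hA`.  The maps `πp`, `πm`
are the projections onto `ker (1 - A)` and `ker (1 + A)` coming from the (unique)
graph-orthogonal decomposition `dom A = dom A₀ ⊕_A ker (1 - A) ⊕_A ker (1 + A)`;
`Pm1` is the `H`-orthogonal projection onto `ker (1 + A)`.  `B` is the m-accretive
restriction of `A` to `Dset` with associated contraction `h`. -/

open RealInnerProductSpace

/-- If `u = u₀ + p + m` with `u₀ ∈ dom A₀`, `p ∈ ker (1 - A)`, `m ∈ ker (1 + A)` and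
`u + A u = 2 v` with `v ∈ ker (1 - A)`, then `p = v` and `u₀ = 0`. -/
theorem kernel_component_of_add_eq_two_smul {H : Type*} [NormedAddCommGroup H]
    [InnerProductSpace ℝ H]
    {domA₀ domA : Submodule ℝ H} {A₀ A : H →ₗ[ℝ] H}
    (hskew : ∀ u ∈ domA₀, ∀ v ∈ domA₀, ⟪A₀ u, v⟫ = -⟪u, A₀ v⟫)
    (hA : ∀ v w : H, (v ∈ domA ∧ A v = w) ↔ ∀ u ∈ domA₀, ⟪A₀ u, v⟫ = -⟪u, w⟫)
    {u p m v : H} (hu₀ : u - p - m ∈ domA₀) (hp : p ∈ domA) (hAp : A p = p)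
    (hAm : A m = -m) (hv : v ∈ domA) (hAv : A v = v) (huv : u + A u = (2 : ℝ) • v) :
    p = v ∧ u - p - m = 0 := by
  have hext : A (u - p - m) = A₀ (u - p - m) :=
    ((hA _ _).2 fun x hx => hskew x hx _ hu₀).2
  have hsum : (u - p - m) + A₀ (u - p - m) = (2 : ℝ) • (v - p) := by
    rw [← hext, map_sub, map_sub, hAp, hAm, smul_sub, ← huv]
    module
  have horth := (hA (v - p) (v - p)).1 ⟨domA.sub_mem hv hp, by rw [map_sub, hAv, hAp]⟩ _ hu₀
  have hvp : v - p = 0 := by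
    have hinner := congrArg (fun x => ⟪x, v - p⟫) hsum
    simp only [inner_add_left, real_inner_smul_left, horth] at hinner
    exact inner_self_eq_zero.1 (show ⟪v - p, v - p⟫ = 0 by linarith)
  refine ⟨(sub_eq_zero.1 hvp).symm, ?_⟩
  rw [hvp, smul_zero] at hsum
  have hself := hskew _ hu₀ _ hu₀
  rw [eq_neg_of_add_eq_zero_right hsum, inner_neg_left, inner_neg_right] at hself
  exact inner_self_eq_zero.1 (show ⟪u - p - m, u - p - m⟫ = 0 by linarith)

/-- For every `v ∈ ker (1 - A)` there is a unique `u ∈ dom B` with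
`u + A u = 2 v`, and `h v = π₋₁ u = ½ P_{ker (1+A)} (u - A u)`; in particular `h` is
uniquely determined by `B`. -/
theorem stmt8 {H : Type*} [NormedAddCommGroup H] [InnerProductSpace ℝ H] [CompleteSpace H]
    (domA₀ : Submodule ℝ H) (A₀ : H →ₗ[ℝ] H)
    (hdense : Dense (domA₀ : Set H))
    (hskew : ∀ u ∈ domA₀, ∀ v ∈ domA₀, ⟪A₀ u, v⟫ = -⟪u, A₀ v⟫)
    (hclosed : IsClosed {p : H × H | p.1 ∈ domA₀ ∧ p.2 = A₀ p.1})
    (domA : Submodule ℝ H) (A : H →ₗ[ℝ] H)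
    (hA : ∀ v w : H, (v ∈ domA ∧ A v = w) ↔ ∀ u ∈ domA₀, ⟪A₀ u, v⟫ = -⟪u, w⟫)
    (πp πm : H → H)
    (hπ : ∀ u ∈ domA, (u - πp u - πm u) ∈ domA₀ ∧
      (πp u ∈ domA ∧ A (πp u) = πp u) ∧ (πm u ∈ domA ∧ A (πm u) = -(πm u)))
    (Pm1 : H → H)
    (hPm1 : ∀ x : H, (Pm1 x ∈ domA ∧ A (Pm1 x) = -(Pm1 x)) ∧
      ∀ z, z ∈ domA → A z = -z → ⟪x - Pm1 x, z⟫ = 0)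
    (Dset : Set H) (hDsub : Dset ⊆ (domA : Set H))
    (hB : MAccretive {p : H × H | p.1 ∈ Dset ∧ p.2 = A p.1})
    (h : H → H)
    (hmap : ∀ x ∈ domA, A x = x → h x ∈ domA ∧ A (h x) = -(h x))
    (hcon : ∀ x ∈ domA, ∀ y ∈ domA, A x = x → A y = y → ‖h x - h y‖ ≤ ‖x - y‖)
    (hdom : Dset = {u : H | u ∈ domA ∧ h (πp u) = πm u}) :
    ∀ v ∈ domA, A v = v →
      (∃! u : H, u ∈ Dset ∧ u + A u = (2 : ℝ) • v) ∧
      (∀ u ∈ Dset, u + A u = (2 : ℝ) • v →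
        h v = πm u ∧ h v = (2 : ℝ)⁻¹ • Pm1 (u - A u)) ∧
      (∀ h' : H → H, (∀ x ∈ domA, A x = x → h' x ∈ domA ∧ A (h' x) = -(h' x)) →
        (∀ x ∈ domA, ∀ y ∈ domA, A x = x → A y = y → ‖h' x - h' y‖ ≤ ‖x - y‖) →
        Dset = {u : H | u ∈ domA ∧ h' (πp u) = πm u} → h' v = h v) := by
  have hcomp : ∀ v ∈ domA, A v = v → ∀ u ∈ Dset, u + A u = (2 : ℝ) • v →
      πp u = v ∧ u - πp u - πm u = 0 := fun v hv hAv u hu huv =>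
    have ⟨hu₀, hp, hm⟩ := hπ u (hDsub hu)
    kernel_component_of_add_eq_two_smul hskew hA hu₀ hp.1 hp.2 hm.2 hv hAv huv
  intro v hv hAv
  obtain ⟨⟨u, w⟩, ⟨hu, hw⟩, huv⟩ := hB.2 ((2 : ℝ) • v)
  dsimp only at hu hw huv
  subst hw
  refine ⟨⟨u, ⟨hu, huv⟩, ?_⟩, ?_, ?_⟩
  · rintro y ⟨hy, hyv⟩
    have hacc : 0 ≤ ⟪y - u, A y - A u⟫ := hB.1 (y, A y) ⟨hy, rfl⟩ (u, A u) ⟨hu, rfl⟩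
    have hneg : A y - A u = -(y - u) := by
      rw [eq_sub_of_add_eq' hyv, eq_sub_of_add_eq' huv]
      abel
    rw [hneg, inner_neg_right] at hacc
    exact sub_eq_zero.1 (real_inner_self_nonpos.1 (show ⟪y - u, y - u⟫ ≤ 0 by linarith))
  · intro y hy hyv
    obtain ⟨hpv, hy₀⟩ := hcomp v hv hAv y hy hyv
    have hhv : h v = πm y := by
      rw [hdom] at hy
      rw [← hpv, hy.2]
    refine ⟨hhv, ?_⟩
    obtain ⟨-, -, hm, hAm⟩ := hπ y (hDsub hy)
    have hdiff : y - A y = (2 : ℝ) • πm y := by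
      rw [eq_sub_of_add_eq' hyv, ← sub_eq_zero.1 hy₀, hpv]
      module
    obtain ⟨⟨hP, hAP⟩, hPorth⟩ := hPm1 (y - A y)
    have hzero := hPorth (y - A y - Pm1 (y - A y))
      (domA.sub_mem (hdiff ▸ domA.smul_mem _ hm) hP) (by
        rw [map_sub, hAP, hdiff, map_smul, hAm]
        module)
    rw [hhv, ← sub_eq_zero.1 (inner_self_eq_zero.1 hzero), hdiff, smul_smul]
    norm_num
  · intro h' _ _ hdom'
    have hpv := (hcomp v hv hAv u hu huv).1
    have h1 : h (πp u) = πm u := (hdom ▸ hu : u ∈ {u : H | u ∈ domA ∧ h (πp u) = πm u}).2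
    have h2 : h' (πp u) = πm u := (hdom' ▸ hu : u ∈ {u : H | u ∈ domA ∧ h' (πp u) = πm u}).2
    rw [← hpv, h1, h2]
end

section
/- Let B be an m-accretive restriction of A with associated contraction h : ker(1−A) → ker(1+A), i.e. dom(B) = {u ∈ dom(A) : h(π₁u) = π₋₁u}. Then dom(A₀) ⊆ dom(B) if and only if h(0) = 0, and dom(B) is a linear subspace of H (i.e. B is a linear operator) if and only if h is additive and homogeneous (linear). -/
/- Setting: `H` a real Hilbert space, `A₀` a closed, densely defined, skew-symmetric linear
operator with domain `domA₀`, and `A = -A₀*` characterised by `hA`.  The maps `πp`, `πm`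
are the projections onto `ker (1 - A)` and `ker (1 + A)` coming from the (unique)
graph-orthogonal decomposition `dom A = dom A₀ ⊕_A ker (1 - A) ⊕_A ker (1 + A)`.
`B` is the m-accretive restriction of `A` with domain
`Dset = {u ∈ dom A : h (π₁ u) = π₋₁ u}` for a contraction `h`. -/

open RealInnerProductSpace

/-- The sum of `dom A₀`, `ker (1 - A)` and `ker (1 + A)` is direct. -/
theorem eq_zero_of_add_add_eq_zero {H : Type*} [NormedAddCommGroup H] [InnerProductSpace ℝ H]
    {domA₀ domA : Submodule ℝ H} {A₀ A : H →ₗ[ℝ] H}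
    (hskew : ∀ u ∈ domA₀, ∀ v ∈ domA₀, ⟪A₀ u, v⟫ = -⟪u, A₀ v⟫)
    (hA : ∀ v w : H, (v ∈ domA ∧ A v = w) ↔ ∀ u ∈ domA₀, ⟪A₀ u, v⟫ = -⟪u, w⟫)
    {d x y : H} (hd : d ∈ domA₀) (hx : x ∈ domA) (hAx : A x = x) (hy : y ∈ domA)
    (hAy : A y = -y) (hsum : d + x + y = 0) : x = 0 ∧ y = 0 := by
  have hAd : A d = A₀ d := ((hA d (A₀ d)).2 fun u hu => hskew u hu d hd).2
  have hd' : d = -x - y := by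
    rw [← sub_eq_zero, ← hsum]; abel
  have hA₀d : A₀ d = y - x := by
    rw [← hAd, hd', map_sub, map_neg, hAx, hAy]; abel
  have h₁ := (hA x x).1 ⟨hx, hAx⟩ d hd
  have h₂ := (hA y (-y)).1 ⟨hy, hAy⟩ d hd
  rw [hA₀d, hd'] at h₁ h₂
  simp only [inner_sub_left, inner_neg_left, inner_neg_right] at h₁ h₂
  constructor
  · exact (inner_self_eq_zero (𝕜 := ℝ)).1 (by linarith)
  · exact (inner_self_eq_zero (𝕜 := ℝ)).1 (by linarith)

/-- `dom A₀ ⊆ dom B` iff `h 0 = 0`, and `dom B` is a linear subspace of `H`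
(i.e. `B` is linear) iff `h` is additive and homogeneous on `ker (1 - A)`. -/
theorem stmt9 {H : Type*} [NormedAddCommGroup H] [InnerProductSpace ℝ H] [CompleteSpace H]
    (domA₀ : Submodule ℝ H) (A₀ : H →ₗ[ℝ] H)
    (hdense : Dense (domA₀ : Set H))
    (hskew : ∀ u ∈ domA₀, ∀ v ∈ domA₀, ⟪A₀ u, v⟫ = -⟪u, A₀ v⟫)
    (hclosed : IsClosed {p : H × H | p.1 ∈ domA₀ ∧ p.2 = A₀ p.1})
    (domA : Submodule ℝ H) (A : H →ₗ[ℝ] H)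
    (hA : ∀ v w : H, (v ∈ domA ∧ A v = w) ↔ ∀ u ∈ domA₀, ⟪A₀ u, v⟫ = -⟪u, w⟫)
    (πp πm : H → H)
    (hπ : ∀ u ∈ domA, (u - πp u - πm u) ∈ domA₀ ∧
      (πp u ∈ domA ∧ A (πp u) = πp u) ∧ (πm u ∈ domA ∧ A (πm u) = -(πm u)))
    (h : H → H)
    (hmap : ∀ x ∈ domA, A x = x → h x ∈ domA ∧ A (h x) = -(h x))
    (hcon : ∀ x ∈ domA, ∀ y ∈ domA, A x = x → A y = y → ‖h x - h y‖ ≤ ‖x - y‖)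
    (Dset : Set H) (hdom : Dset = {u : H | u ∈ domA ∧ h (πp u) = πm u}) :
    ((domA₀ : Set H) ⊆ Dset ↔ h 0 = 0) ∧
    ((∃ S : Submodule ℝ H, (S : Set H) = Dset) ↔
      ((∀ x ∈ domA, ∀ y ∈ domA, A x = x → A y = y → h (x + y) = h x + h y) ∧
       (∀ c : ℝ, ∀ x ∈ domA, A x = x → h (c • x) = c • h x))) := by
  have hsub : ∀ d ∈ domA₀, d ∈ domA := fun d hd =>
    ((hA d (A₀ d)).2 fun u hu => hskew u hu d hd).1
  have huniq : ∀ u ∈ domA, ∀ x ∈ domA, ∀ y ∈ domA, A x = x → A y = -y → u - x - y ∈ domA₀ →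
      πp u = x ∧ πm u = y := by
    intro u hu x hx y hy hAx hAy hd
    obtain ⟨hd', ⟨hp, hAp⟩, hm, hAm⟩ := hπ u hu
    have key := eq_zero_of_add_add_eq_zero hskew hA (domA₀.sub_mem hd' hd)
      (domA.sub_mem hp hx) (by rw [map_sub, hAp, hAx]) (domA.sub_mem hm hy)
      (by rw [map_sub, hAm, hAy]; abel) (by abel)
    exact ⟨sub_eq_zero.1 key.1, sub_eq_zero.1 key.2⟩
  have hmem : ∀ x ∈ domA, ∀ y ∈ domA, A x = x → A y = -y → (x + y ∈ Dset ↔ h x = y) := by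
    intro x hx y hy hAx hAy
    have hxy := domA.add_mem hx hy
    obtain ⟨hp, hm⟩ := huniq (x + y) hxy x hx y hy hAx hAy (by simp)
    simp [hdom, hxy, hp, hm]
  have hzero : (0 : H) ∈ Dset ↔ h 0 = 0 := by
    simpa using hmem 0 domA.zero_mem 0 domA.zero_mem (by simp) (by simp)
  refine ⟨⟨fun hs => hzero.1 (hs domA₀.zero_mem), fun h0 d hd => ?_⟩, ?_, ?_⟩
  · obtain ⟨hp, hm⟩ := huniq d (hsub d hd) 0 domA.zero_mem 0 domA.zero_mem (by simp) (by simp)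
      (by simpa using hd)
    rw [hdom]
    exact ⟨hsub d hd, by rw [hp, hm, h0]⟩
  · rintro ⟨S, rfl⟩
    have hgraph : ∀ x ∈ domA, A x = x → x + h x ∈ S := fun x hx hAx =>
      (hmem x hx (h x) (hmap x hx hAx).1 hAx (hmap x hx hAx).2).2 rfl
    constructor
    · intro x hx y hy hAx hAy
      obtain ⟨hhx, hAhx⟩ := hmap x hx hAx
      obtain ⟨hhy, hAhy⟩ := hmap y hy hAy
      refine (hmem (x + y) (domA.add_mem hx hy) (h x + h y) (domA.add_mem hhx hhy)
        (by rw [map_add, hAx, hAy]) (by rw [map_add, hAhx, hAhy]; abel)).1 ?_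
      rw [add_add_add_comm]
      exact S.add_mem (hgraph x hx hAx) (hgraph y hy hAy)
    · intro c x hx hAx
      obtain ⟨hhx, hAhx⟩ := hmap x hx hAx
      refine (hmem (c • x) (domA.smul_mem c hx) (c • h x) (domA.smul_mem c hhx)
        (by rw [map_smul, hAx]) (by rw [map_smul, hAhx, smul_neg])).1 ?_
      rw [← smul_add]
      exact S.smul_mem c (hgraph x hx hAx)
  · rintro ⟨hadd, hsmul⟩
    refine ⟨⟨⟨⟨Dset, ?_⟩, ?_⟩, ?_⟩, rfl⟩
    · intro u v hu hv
      rw [hdom] at hu hv ⊢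
      obtain ⟨hu, hhu⟩ := hu
      obtain ⟨hv, hhv⟩ := hv
      obtain ⟨hdu, ⟨hpu, hApu⟩, hmu, hAmu⟩ := hπ u hu
      obtain ⟨hdv, ⟨hpv, hApv⟩, hmv, hAmv⟩ := hπ v hv
      obtain ⟨hp, hm⟩ := huniq (u + v) (domA.add_mem hu hv) (πp u + πp v)
        (domA.add_mem hpu hpv) (πm u + πm v) (domA.add_mem hmu hmv)
        (by rw [map_add, hApu, hApv]) (by rw [map_add, hAmu, hAmv]; abel)
        (by convert domA₀.add_mem hdu hdv using 1; abel)
      exact ⟨domA.add_mem hu hv,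
        by rw [hp, hm, hadd _ hpu _ hpv hApu hApv, hhu, hhv]⟩
    · exact hzero.2 (by simpa using hsmul 0 0 domA.zero_mem (by simp))
    · intro c u hu
      change u ∈ Dset at hu
      change c • u ∈ Dset
      rw [hdom] at hu ⊢
      obtain ⟨hu, hhu⟩ := hu
      obtain ⟨hdu, ⟨hpu, hApu⟩, hmu, hAmu⟩ := hπ u hu
      obtain ⟨hp, hm⟩ := huniq (c • u) (domA.smul_mem c hu) (c • πp u)
        (domA.smul_mem c hpu) (c • πm u) (domA.smul_mem c hmu)
        (by rw [map_smul, hApu]) (by rw [map_smul, hAmu, smul_neg])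
        (by rw [← smul_sub, ← smul_sub]; exact domA₀.smul_mem c hdu)
      exact ⟨domA.smul_mem c hu, by rw [hp, hm, hsmul c _ hpu hApu, hhu]⟩
end

section
/- Let A be the block operator (u,v) ↦ (Dv, Gu) on dom(A) = dom(G) × dom(D) and let π₁, π₋₁ be the projections coming from the graph-orthogonal decomposition dom(A) = dom(A₀) ⊕_A ker(1−A) ⊕_A ker(1+A). Then for every (u, v) ∈ dom(A): π₁(u, v) = ½ (u_BD + D v_BD, G u_BD + v_BD) and π₋₁(u, v) = ½ (u_BD − D v_BD, −G u_BD + v_BD). -/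
/- Setting: `H₀`, `H₁` real Hilbert spaces; `G₀`, `D₀` closed densely defined operators with
domains `domG₀`, `domD₀`; `G = -D₀*` and `D = -G₀*` characterised by `hG`, `hD`, with
`G ⊇ G₀`, `D ⊇ D₀`.  `A₀` is the block operator `(u, v) ↦ (D₀ v, G₀ u)` and
`A = -A₀* = (u, v) ↦ (D v, G u)` with `dom A = dom G × dom D`.
`pG u` (resp. `pD v`) is the graph-orthogonal projection `u_BD` of `u ∈ dom G` onto
`BD(G) = {u ∈ dom (DG) : DGu = u}` (resp. `v_BD` onto `BD(D)`), characterised by `hpG`, `hpD`.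
A decomposition `(u, v) = (x₀, y₀) + (x₁, y₁) + (x₂, y₂)` into
`dom A₀ ⊕ ker (1 - A) ⊕ ker (1 + A)` exhibits `(x₁, y₁) = π₁ (u, v)` and
`(x₂, y₂) = π₋₁ (u, v)` (the decomposition is unique). -/

open RealInnerProductSpace

/-- If `S = -T₀*` and `T₀ ⊆ T`, then an element of `dom T₀` with `S T z = z` vanishes. -/
theorem eq_zero_of_mem_dom_of_boundary_data {E F : Type*} [NormedAddCommGroup E]
    [InnerProductSpace ℝ E] [NormedAddCommGroup F] [InnerProductSpace ℝ F]
    {domT₀ : Submodule ℝ E} {T₀ T : E →ₗ[ℝ] F} {domS : Submodule ℝ F} {S : F →ₗ[ℝ] E}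
    (hS : ∀ (v : F) (w : E), (v ∈ domS ∧ S v = w) ↔ ∀ u ∈ domT₀, ⟪T₀ u, v⟫ = -⟪u, w⟫)
    (hT : ∀ u ∈ domT₀, T u = T₀ u) {z : E} (hz : z ∈ domT₀) (hTz : T z ∈ domS)
    (hSTz : S (T z) = z) : z = 0 := by
  have h := (hS (T z) z).mp ⟨hTz, hSTz⟩ z hz
  rw [← hT z hz] at h
  have hw : 0 ≤ ⟪T z, T z⟫ := real_inner_self_nonneg
  exact real_inner_self_nonpos.mp (by linarith)

/-- For `(u, v) ∈ dom A`:
`π₁ (u, v) = ½ (u_BD + D v_BD, G u_BD + v_BD)` and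
`π₋₁ (u, v) = ½ (u_BD - D v_BD, -G u_BD + v_BD)`. -/
theorem stmt12 {H₀ H₁ : Type*} [NormedAddCommGroup H₀] [InnerProductSpace ℝ H₀]
    [CompleteSpace H₀] [NormedAddCommGroup H₁] [InnerProductSpace ℝ H₁] [CompleteSpace H₁]
    (domG₀ : Submodule ℝ H₀) (G₀ : H₀ →ₗ[ℝ] H₁)
    (domD₀ : Submodule ℝ H₁) (D₀ : H₁ →ₗ[ℝ] H₀)
    (hdG₀ : Dense (domG₀ : Set H₀)) (hdD₀ : Dense (domD₀ : Set H₁))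
    (hclG₀ : IsClosed {p : H₀ × H₁ | p.1 ∈ domG₀ ∧ p.2 = G₀ p.1})
    (hclD₀ : IsClosed {p : H₁ × H₀ | p.1 ∈ domD₀ ∧ p.2 = D₀ p.1})
    (domG : Submodule ℝ H₀) (G : H₀ →ₗ[ℝ] H₁)
    (domD : Submodule ℝ H₁) (D : H₁ →ₗ[ℝ] H₀)
    (hG : ∀ (u : H₀) (w : H₁), (u ∈ domG ∧ G u = w) ↔ ∀ v ∈ domD₀, ⟪D₀ v, u⟫ = -⟪v, w⟫)
    (hD : ∀ (v : H₁) (w : H₀), (v ∈ domD ∧ D v = w) ↔ ∀ u ∈ domG₀, ⟪G₀ u, v⟫ = -⟪u, w⟫)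
    (hGG₀ : ∀ u ∈ domG₀, u ∈ domG ∧ G u = G₀ u)
    (hDD₀ : ∀ v ∈ domD₀, v ∈ domD ∧ D v = D₀ v)
    (pG : H₀ → H₀) (pD : H₁ → H₁)
    (hpG : ∀ u ∈ domG, (pG u ∈ domG ∧ G (pG u) ∈ domD ∧ D (G (pG u)) = pG u) ∧
      u - pG u ∈ domG₀)
    (hpD : ∀ v ∈ domD, (pD v ∈ domD ∧ D (pD v) ∈ domG ∧ G (D (pD v)) = pD v) ∧
      v - pD v ∈ domD₀)
    (u : H₀) (hu : u ∈ domG) (v : H₁) (hv : v ∈ domD)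
    (x₀ x₁ x₂ : H₀) (y₀ y₁ y₂ : H₁)
    (hx₀ : x₀ ∈ domG₀) (hy₀ : y₀ ∈ domD₀)
    (h1 : x₁ ∈ domG ∧ y₁ ∈ domD ∧ D y₁ = x₁ ∧ G x₁ = y₁)
    (h2 : x₂ ∈ domG ∧ y₂ ∈ domD ∧ D y₂ = -x₂ ∧ G x₂ = -y₂)
    (hdecu : u = x₀ + x₁ + x₂) (hdecv : v = y₀ + y₁ + y₂) :
    x₁ = (2 : ℝ)⁻¹ • (pG u + D (pD v)) ∧ y₁ = (2 : ℝ)⁻¹ • (G (pG u) + pD v) ∧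
    x₂ = (2 : ℝ)⁻¹ • (pG u - D (pD v)) ∧ y₂ = (2 : ℝ)⁻¹ • (pD v - G (pG u)) := by
  obtain ⟨hx₁, hy₁, hDy₁, hGx₁⟩ := h1
  obtain ⟨hx₂, hy₂, hDy₂, hGx₂⟩ := h2
  obtain ⟨⟨-, hGpu, hDGpu⟩, hup⟩ := hpG u hu
  obtain ⟨⟨-, hDpv, hGDpv⟩, hvp⟩ := hpD v hv
  have hpu : pG u = x₁ + x₂ := by
    have hmem : pG u - (x₁ + x₂) ∈ domG₀ := by
      convert domG₀.sub_mem hx₀ hup using 1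
      rw [hdecu]
      abel
    have hGz : G (pG u - (x₁ + x₂)) = G (pG u) - (y₁ - y₂) := by
      rw [map_sub, map_add, hGx₁, hGx₂, ← sub_eq_add_neg]
    refine sub_eq_zero.mp (eq_zero_of_mem_dom_of_boundary_data hD (fun z hz => (hGG₀ z hz).2)
      hmem ?_ ?_)
    · rw [hGz]
      exact domD.sub_mem hGpu (domD.sub_mem hy₁ hy₂)
    · rw [hGz, map_sub, map_sub, hDGpu, hDy₁, hDy₂, sub_neg_eq_add]
  have hpv : pD v = y₁ + y₂ := by
    have hmem : pD v - (y₁ + y₂) ∈ domD₀ := by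
      convert domD₀.sub_mem hy₀ hvp using 1
      rw [hdecv]
      abel
    have hDz : D (pD v - (y₁ + y₂)) = D (pD v) - (x₁ - x₂) := by
      rw [map_sub, map_add, hDy₁, hDy₂, ← sub_eq_add_neg]
    refine sub_eq_zero.mp (eq_zero_of_mem_dom_of_boundary_data hG (fun z hz => (hDD₀ z hz).2)
      hmem ?_ ?_)
    · rw [hDz]
      exact domG.sub_mem hDpv (domG.sub_mem hx₁ hx₂)
    · rw [hDz, map_sub, map_sub, hGDpv, hGx₁, hGx₂, sub_neg_eq_add]
  rw [hpu, hpv, map_add, map_add, hGx₁, hGx₂, hDy₁, hDy₂]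
  refine ⟨?_, ?_, ?_, ?_⟩ <;> module
end

section
/- Let C = {((u,v), A(u,v)) : (u,v) ∈ D} be a restriction of the block operator A to a subset D ⊆ dom(A). The following are equivalent: (i) C is m-accretive as a relation on H₀ ⊕ H₁; (ii) there exists f : BD(G) → BD(G) with ‖f(x) − f(y)‖_{BD(G)} ≤ ‖x − y‖_{BD(G)} (graph norm of G) such that D = {(u,v) ∈ dom(A) : f(½(u_BD + D v_BD)) = ½(u_BD − D v_BD)}; (iii) there exists an m-accretive relation M ⊆ BD(G) × BD(G) (with respect to the graph inner product of G) such that D = {(u,v) ∈ dom(A) : (u_BD, D v_BD) ∈ M}. -/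
/- Setting: `H₀`, `H₁` real Hilbert spaces; `G₀`, `D₀` closed densely defined operators with
domains `domG₀`, `domD₀`; `G = -D₀*` and `D = -G₀*` characterised by `hG`, `hD`, with
`G ⊇ G₀`, `D ⊇ D₀`.  `A` is the block operator `(u, v) ↦ (D v, G u)` with
`dom A = dom G × dom D`.  `pG u = u_BD` and `pD v = v_BD` are the graph-orthogonal
projections onto `BD(G)` and `BD(D)`.  `C` is the restriction of `A` to `Dset ⊆ dom A`.
Relations on `H₀ ⊕ H₁` use the inner product `⟪(a,b),(c,d)⟫ = ⟪a,c⟫ + ⟪b,d⟫`; relations on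
`BD(G)` use the graph inner product `⟪x,y⟫ + ⟪G x, G y⟫`. -/

open RealInnerProductSpace

/-- `u ∈ BD(G)`. -/
def IsBDG {H₀ H₁ : Type*} [NormedAddCommGroup H₀] [InnerProductSpace ℝ H₀]
    [NormedAddCommGroup H₁] [InnerProductSpace ℝ H₁]
    (domG : Submodule ℝ H₀) (G : H₀ →ₗ[ℝ] H₁)
    (domD : Submodule ℝ H₁) (D : H₁ →ₗ[ℝ] H₀) (u : H₀) : Prop :=
  u ∈ domG ∧ G u ∈ domD ∧ D (G u) = u

/-- A relation on `H₀ ⊕ H₁` is accretive (with the Hilbert direct sum inner product). -/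
def AccretiveProd {H₀ H₁ : Type*} [NormedAddCommGroup H₀] [InnerProductSpace ℝ H₀]
    [NormedAddCommGroup H₁] [InnerProductSpace ℝ H₁]
    (M : Set ((H₀ × H₁) × (H₀ × H₁))) : Prop :=
  ∀ p ∈ M, ∀ q ∈ M,
    0 ≤ ⟪p.1.1 - q.1.1, p.2.1 - q.2.1⟫ + ⟪p.1.2 - q.1.2, p.2.2 - q.2.2⟫

/-- A relation on `H₀ ⊕ H₁` is m-accretive. -/
def MAccretiveProd {H₀ H₁ : Type*} [NormedAddCommGroup H₀] [InnerProductSpace ℝ H₀]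
    [NormedAddCommGroup H₁] [InnerProductSpace ℝ H₁]
    (M : Set ((H₀ × H₁) × (H₀ × H₁))) : Prop :=
  AccretiveProd M ∧ ∀ f : H₀ × H₁, ∃ p ∈ M, p.1 + p.2 = f

/-- A relation on `BD(G)` is accretive with respect to the graph inner product of `G`. -/
def AccretiveBDG {H₀ H₁ : Type*} [NormedAddCommGroup H₀] [InnerProductSpace ℝ H₀]
    [NormedAddCommGroup H₁] [InnerProductSpace ℝ H₁]
    (G : H₀ →ₗ[ℝ] H₁) (M : Set (H₀ × H₀)) : Prop :=
  ∀ p ∈ M, ∀ q ∈ M,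
    0 ≤ ⟪p.1 - q.1, p.2 - q.2⟫ + ⟪G p.1 - G q.1, G p.2 - G q.2⟫

/-- A relation on `BD(G)` is m-accretive with respect to the graph inner product of `G`. -/
def MAccretiveBDG {H₀ H₁ : Type*} [NormedAddCommGroup H₀] [InnerProductSpace ℝ H₀]
    [NormedAddCommGroup H₁] [InnerProductSpace ℝ H₁]
    (domG : Submodule ℝ H₀) (G : H₀ →ₗ[ℝ] H₁)
    (domD : Submodule ℝ H₁) (D : H₁ →ₗ[ℝ] H₀) (M : Set (H₀ × H₀)) : Prop :=
  AccretiveBDG G M ∧ ∀ f : H₀, IsBDG domG G domD D f → ∃ p ∈ M, p.1 + p.2 = f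

section Helpers

variable {H₀ H₁ : Type*} [NormedAddCommGroup H₀] [InnerProductSpace ℝ H₀]
  [NormedAddCommGroup H₁] [InnerProductSpace ℝ H₁]

/-- The boundary data space `BD(G)` as a submodule. -/
def boundaryData (domG : Submodule ℝ H₀) (G : H₀ →ₗ[ℝ] H₁)
    (domD : Submodule ℝ H₁) (D : H₁ →ₗ[ℝ] H₀) : Submodule ℝ H₀ where
  carrier := {u | IsBDG domG G domD D u}
  zero_mem' := by simp [IsBDG]
  add_mem' := by
    rintro a b ⟨ha, hGa, hDa⟩ ⟨hb, hGb, hDb⟩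
    exact ⟨domG.add_mem ha hb, by rw [map_add]; exact domD.add_mem hGa hGb,
      by rw [map_add, map_add, hDa, hDb]⟩
  smul_mem' := by
    rintro c a ⟨ha, hGa, hDa⟩
    exact ⟨domG.smul_mem c ha, by rw [map_smul]; exact domD.smul_mem c hGa,
      by rw [map_smul, map_smul, hDa]⟩

/-- Polarisation for the half sum and the half difference in the graph norm. -/
theorem graph_inner_eq_half_add_sub (G : H₀ →ₗ[ℝ] H₁) (a b : H₀) :
    ⟪a, b⟫ + ⟪G a, G b⟫ =
      (‖(2 : ℝ)⁻¹ • (a + b)‖ ^ 2 + ‖G ((2 : ℝ)⁻¹ • (a + b))‖ ^ 2) -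
        (‖(2 : ℝ)⁻¹ • (a - b)‖ ^ 2 + ‖G ((2 : ℝ)⁻¹ • (a - b))‖ ^ 2) := by
  simp only [map_smul, map_add, map_sub, norm_smul, mul_pow, norm_add_sq_real, norm_sub_sq_real,
    Real.norm_eq_abs, sq_abs]
  ring

theorem AccretiveBDG.eq_of_add_eq {G : H₀ →ₗ[ℝ] H₁} {M : Set (H₀ × H₀)}
    (hM : AccretiveBDG G M) {p q : H₀ × H₀} (hp : p ∈ M) (hq : q ∈ M)
    (h : p.1 + p.2 = q.1 + q.2) : p = q := by
  have h2 : p.2 - q.2 = -(p.1 - q.1) := by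
    rw [eq_neg_iff_add_eq_zero, ← sub_eq_zero.mpr h]; abel
  have h0 := hM p hp q hq
  rw [← map_sub, ← map_sub, h2, map_neg, inner_neg_right, inner_neg_right,
    real_inner_self_eq_norm_sq, real_inner_self_eq_norm_sq] at h0
  have h1 : ‖p.1 - q.1‖ ^ 2 = 0 :=
    le_antisymm (by nlinarith [sq_nonneg ‖G (p.1 - q.1)‖]) (sq_nonneg _)
  have h3 : p.1 - q.1 = 0 := by simpa using h1
  rw [h3, neg_zero] at h2
  exact Prod.ext (sub_eq_zero.mp h3) (sub_eq_zero.mp h2)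

/-- The Cayley transform of an m-accretive relation on `BD(G)` is a contraction. -/
theorem MAccretiveBDG.exists_contraction {domG : Submodule ℝ H₀} {G : H₀ →ₗ[ℝ] H₁}
    {domD : Submodule ℝ H₁} {D : H₁ →ₗ[ℝ] H₀} {M : Set (H₀ × H₀)}
    (hMsub : ∀ p ∈ M, IsBDG domG G domD D p.1 ∧ IsBDG domG G domD D p.2)
    (hM : MAccretiveBDG domG G domD D M) :
    ∃ f : H₀ → H₀,
      (∀ u, IsBDG domG G domD D u → IsBDG domG G domD D (f u)) ∧
      (∀ x y, IsBDG domG G domD D x → IsBDG domG G domD D y →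
        Real.sqrt (‖f x - f y‖ ^ 2 + ‖G (f x) - G (f y)‖ ^ 2) ≤
          Real.sqrt (‖x - y‖ ^ 2 + ‖G x - G y‖ ^ 2)) ∧
      ∀ x y, IsBDG domG G domD D x → IsBDG domG G domD D y →
        ((x, y) ∈ M ↔ f ((2 : ℝ)⁻¹ • (x + y)) = (2 : ℝ)⁻¹ • (x - y)) := by
  obtain ⟨hacc, hran⟩ := hM
  have hex : ∀ w : H₀, ∃ p : H₀ × H₀,
      IsBDG domG G domD D w → p ∈ M ∧ p.1 + p.2 = (2 : ℝ) • w := by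
    intro w
    by_cases hw : IsBDG domG G domD D w
    · obtain ⟨p, hp, hp'⟩ := hran ((2 : ℝ) • w)
        ((boundaryData domG G domD D).smul_mem (2 : ℝ) hw)
      exact ⟨p, fun _ => ⟨hp, hp'⟩⟩
    · exact ⟨0, fun h => absurd h hw⟩
  choose P hP using hex
  have hhalf : ∀ w, IsBDG domG G domD D w →
      w = (2 : ℝ)⁻¹ • ((P w).1 + (P w).2) := by
    intro w hw
    rw [(hP w hw).2, smul_smul, inv_mul_cancel₀ two_ne_zero, one_smul]
  refine ⟨fun w => (2 : ℝ)⁻¹ • ((P w).1 - (P w).2), ?_, ?_, ?_⟩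
  · intro w hw
    obtain ⟨h1, h2⟩ := hMsub _ (hP w hw).1
    exact (boundaryData domG G domD D).smul_mem _ ((boundaryData domG G domD D).sub_mem h1 h2)
  · intro x y hx hy
    apply Real.sqrt_le_sqrt
    have h0 := hacc _ (hP x hx).1 _ (hP y hy).1
    rw [← map_sub, ← map_sub, graph_inner_eq_half_add_sub] at h0
    have e1 : (2 : ℝ)⁻¹ • ((P x).1 - (P y).1 + ((P x).2 - (P y).2)) = x - y := by
      conv_rhs => rw [hhalf x hx, hhalf y hy]
      rw [← smul_sub]; congr 1; abel
    have e2 : (2 : ℝ)⁻¹ • ((P x).1 - (P y).1 - ((P x).2 - (P y).2)) =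
        (2 : ℝ)⁻¹ • ((P x).1 - (P x).2) - (2 : ℝ)⁻¹ • ((P y).1 - (P y).2) := by
      rw [← smul_sub]; congr 1; abel
    rw [e1, e2, map_sub, map_sub] at h0
    exact sub_nonneg.mp h0
  · intro x y hx hy
    have hw : IsBDG domG G domD D ((2 : ℝ)⁻¹ • (x + y)) :=
      (boundaryData domG G domD D).smul_mem _ ((boundaryData domG G domD D).add_mem hx hy)
    obtain ⟨hp, hadd⟩ := hP _ hw
    rw [smul_smul, mul_inv_cancel₀ two_ne_zero, one_smul] at hadd
    constructor
    · intro hxy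
      have := hacc.eq_of_add_eq hp hxy hadd
      simp only [this]
    · intro h
      have hsub : (P ((2 : ℝ)⁻¹ • (x + y))).1 - (P ((2 : ℝ)⁻¹ • (x + y))).2 = x - y :=
        smul_right_injective H₀ (inv_ne_zero (two_ne_zero (α := ℝ))) h
      have e1 : (P ((2 : ℝ)⁻¹ • (x + y))).1 = x := by
        apply smul_right_injective H₀ (two_ne_zero (α := ℝ))
        have := congrArg₂ (· + ·) hadd hsub
        simp only [two_smul] at this ⊢
        calc _ = _ := by abel
          _ = _ := this
          _ = _ := by abel
      have e2 : (P ((2 : ℝ)⁻¹ • (x + y))).2 = y := by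
        rw [e1] at hadd; exact add_left_cancel hadd
      rwa [show P ((2 : ℝ)⁻¹ • (x + y)) = (x, y) from Prod.ext e1 e2] at hp

/-- The inverse Cayley transform of a contraction of `BD(G)` is m-accretive. -/
theorem exists_mAccretiveBDG_of_contraction {domG : Submodule ℝ H₀} {G : H₀ →ₗ[ℝ] H₁}
    {domD : Submodule ℝ H₁} {D : H₁ →ₗ[ℝ] H₀} {f : H₀ → H₀}
    (hf : ∀ u, IsBDG domG G domD D u → IsBDG domG G domD D (f u))
    (hcon : ∀ x y, IsBDG domG G domD D x → IsBDG domG G domD D y →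
      Real.sqrt (‖f x - f y‖ ^ 2 + ‖G (f x) - G (f y)‖ ^ 2) ≤
        Real.sqrt (‖x - y‖ ^ 2 + ‖G x - G y‖ ^ 2)) :
    ∃ M : Set (H₀ × H₀),
      (∀ p ∈ M, IsBDG domG G domD D p.1 ∧ IsBDG domG G domD D p.2) ∧
      MAccretiveBDG domG G domD D M ∧
      ∀ x y, IsBDG domG G domD D x → IsBDG domG G domD D y →
        ((x, y) ∈ M ↔ f ((2 : ℝ)⁻¹ • (x + y)) = (2 : ℝ)⁻¹ • (x - y)) := by
  have hadd {x y : H₀} (hx : IsBDG domG G domD D x) (hy : IsBDG domG G domD D y) :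
      IsBDG domG G domD D (x + y) := (boundaryData domG G domD D).add_mem hx hy
  have hsub {x y : H₀} (hx : IsBDG domG G domD D x) (hy : IsBDG domG G domD D y) :
      IsBDG domG G domD D (x - y) := (boundaryData domG G domD D).sub_mem hx hy
  have hsmul (c : ℝ) {x : H₀} (hx : IsBDG domG G domD D x) :
      IsBDG domG G domD D (c • x) := (boundaryData domG G domD D).smul_mem c hx
  refine ⟨{p | IsBDG domG G domD D p.1 ∧ IsBDG domG G domD D p.2 ∧
      f ((2 : ℝ)⁻¹ • (p.1 + p.2)) = (2 : ℝ)⁻¹ • (p.1 - p.2)},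
    fun p hp => ⟨hp.1, hp.2.1⟩, ⟨?_, ?_⟩, fun x y hx hy => ⟨fun h => h.2.2, fun h => ⟨hx, hy, h⟩⟩⟩
  · rintro p ⟨hp1, hp2, hp⟩ q ⟨hq1, hq2, hq⟩
    have h := (Real.sqrt_le_sqrt_iff (by positivity)).mp
      (hcon _ _ (hsmul 2⁻¹ (hadd hp1 hp2)) (hsmul 2⁻¹ (hadd hq1 hq2)))
    rw [hp, hq, ← map_sub, ← map_sub] at h
    rw [← map_sub, ← map_sub, graph_inner_eq_half_add_sub]
    have e1 : (2 : ℝ)⁻¹ • (p.1 - q.1 + (p.2 - q.2)) =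
        (2 : ℝ)⁻¹ • (p.1 + p.2) - (2 : ℝ)⁻¹ • (q.1 + q.2) := by
      rw [← smul_sub]; congr 1; abel
    have e2 : (2 : ℝ)⁻¹ • (p.1 - q.1 - (p.2 - q.2)) =
        (2 : ℝ)⁻¹ • (p.1 - p.2) - (2 : ℝ)⁻¹ • (q.1 - q.2) := by
      rw [← smul_sub]; congr 1; abel
    rw [e1, e2]
    exact sub_nonneg.mpr h
  · intro h hh
    have hw := hsmul 2⁻¹ hh
    have e : (2 : ℝ)⁻¹ • h + (2 : ℝ)⁻¹ • h = h := by
      rw [← two_smul ℝ, smul_smul, mul_inv_cancel₀ two_ne_zero, one_smul]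
    have e' : ((2 : ℝ)⁻¹ • h + f ((2 : ℝ)⁻¹ • h)) + ((2 : ℝ)⁻¹ • h - f ((2 : ℝ)⁻¹ • h)) = h := by
      conv_rhs => rw [← e]
      abel
    refine ⟨((2 : ℝ)⁻¹ • h + f ((2 : ℝ)⁻¹ • h), (2 : ℝ)⁻¹ • h - f ((2 : ℝ)⁻¹ • h)),
      ⟨hadd hw (hf _ hw), hsub hw (hf _ hw), ?_⟩, e'⟩
    simp only [e']
    rw [add_sub_sub_cancel, ← two_smul ℝ, smul_smul, inv_mul_cancel₀ two_ne_zero, one_smul]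

/-- If `G₀` is closed and `D = -G₀*`, then `(u, v) ↦ (u + D v, v + G₀ u)` maps
`dom G₀ × dom D` onto `H₀ × H₁`. -/
theorem exists_add_eq_of_isClosed_graph [CompleteSpace H₀] [CompleteSpace H₁]
    {domG₀ : Submodule ℝ H₀} {G₀ : H₀ →ₗ[ℝ] H₁}
    (hcl : IsClosed {p : H₀ × H₁ | p.1 ∈ domG₀ ∧ p.2 = G₀ p.1})
    {domD : Submodule ℝ H₁} {D : H₁ →ₗ[ℝ] H₀}
    (hD : ∀ (v : H₁) (w : H₀), (v ∈ domD ∧ D v = w) ↔ ∀ u ∈ domG₀, ⟪G₀ u, v⟫ = -⟪u, w⟫)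
    (f : H₀) (g : H₁) : ∃ u ∈ domG₀, ∃ v ∈ domD, u + D v = f ∧ v + G₀ u = g := by
  let K : Submodule ℝ (WithLp 2 (H₀ × H₁)) :=
    { carrier := {p | p.fst ∈ domG₀ ∧ p.snd = G₀ p.fst}
      zero_mem' := by simp
      add_mem' := by
        rintro a b ⟨ha, ha'⟩ ⟨hb, hb'⟩
        exact ⟨domG₀.add_mem ha hb, by simp [ha', hb']⟩
      smul_mem' := by
        rintro c a ⟨ha, ha'⟩
        exact ⟨domG₀.smul_mem c ha, by simp [ha']⟩ }
  have hK : IsClosed (K : Set (WithLp 2 (H₀ × H₁))) :=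
    hcl.preimage (WithLp.prod_continuous_ofLp 2 H₀ H₁)
  have : CompleteSpace K := hK.completeSpace_coe
  obtain ⟨k, hk, hperp⟩ :=
    Submodule.HasOrthogonalProjection.exists_orthogonal (K := K) (WithLp.toLp 2 (f, g))
  obtain ⟨hk1, hk2⟩ := hk
  have hv := (hD (g - G₀ k.fst) (f - k.fst)).mpr fun φ hφ => by
    have h := (Submodule.mem_orthogonal K _).mp hperp (WithLp.toLp 2 (φ, G₀ φ)) ⟨hφ, rfl⟩
    rw [WithLp.prod_inner_apply] at h
    simp only [WithLp.ofLp_sub, Prod.fst_sub, Prod.snd_sub] at h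
    rw [show k.ofLp.2 = G₀ k.fst from hk2] at h
    change ⟪φ, f - k.fst⟫ + ⟪G₀ φ, g - G₀ k.fst⟫ = 0 at h
    linarith
  exact ⟨k.fst, hk1, g - G₀ k.fst, hv.1, by rw [hv.2]; abel, by abel⟩

/-- Extrapolation of m-accretivity through traces: if `γ` and `δ` are `BD(G)`-valued traces
satisfying Green's formula, restrictions of the block operator are m-accretive exactly when they
are given by an m-accretive relation between the traces. -/
theorem mAccretiveProd_iff_exists_mAccretiveBDG {domG : Submodule ℝ H₀} {G : H₀ →ₗ[ℝ] H₁}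
    {domD : Submodule ℝ H₁} {D : H₁ →ₗ[ℝ] H₀} {γ : H₀ → H₀} {δ : H₁ → H₀}
    (hγ : ∀ u ∈ domG, IsBDG domG G domD D (γ u))
    (hδ : ∀ v ∈ domD, IsBDG domG G domD D (δ v))
    (hγ_id : ∀ x, IsBDG domG G domD D x → γ x = x)
    (hδ_G : ∀ x, IsBDG domG G domD D x → δ (G x) = x)
    (green : ∀ u ∈ domG, ∀ u' ∈ domG, ∀ v ∈ domD, ∀ v' ∈ domD,
      ⟪u - u', D v - D v'⟫ + ⟪v - v', G u - G u'⟫ =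
        ⟪γ u - γ u', δ v - δ v'⟫ + ⟪G (γ u) - G (γ u'), G (δ v) - G (δ v')⟫)
    (solve : ∀ f g, ∃ y, IsBDG domG G domD D y ∧ ∀ z, IsBDG domG G domD D z →
      ∃ u ∈ domG, ∃ v ∈ domD, u + D v = f ∧ v + G u = g ∧ γ u = z ∧ δ v = y - z)
    {S : Set (H₀ × H₁)} (hS : ∀ p ∈ S, p.1 ∈ domG ∧ p.2 ∈ domD) :
    MAccretiveProd {q : (H₀ × H₁) × (H₀ × H₁) | q.1 ∈ S ∧ q.2 = (D q.1.2, G q.1.1)} ↔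
      ∃ M : Set (H₀ × H₀),
        (∀ p ∈ M, IsBDG domG G domD D p.1 ∧ IsBDG domG G domD D p.2) ∧
        MAccretiveBDG domG G domD D M ∧
        S = {p : H₀ × H₁ | p.1 ∈ domG ∧ p.2 ∈ domD ∧ (γ p.1, δ p.2) ∈ M} := by
  constructor
  · rintro ⟨hacc, hran⟩
    have hacc' : ∀ p ∈ S, ∀ q ∈ S, 0 ≤ ⟪γ p.1 - γ q.1, δ p.2 - δ q.2⟫ +
        ⟪G (γ p.1) - G (γ q.1), G (δ p.2) - G (δ q.2)⟫ := by
      intro p hp q hq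
      rw [← green _ (hS p hp).1 _ (hS q hq).1 _ (hS p hp).2 _ (hS q hq).2]
      exact hacc (p, (D p.2, G p.1)) ⟨hp, rfl⟩ (q, (D q.2, G q.1)) ⟨hq, rfl⟩
    refine ⟨(fun p : H₀ × H₁ => (γ p.1, δ p.2)) '' S, ?_, ⟨?_, ?_⟩, ?_⟩
    · rintro _ ⟨p, hp, rfl⟩
      exact ⟨hγ _ (hS p hp).1, hδ _ (hS p hp).2⟩
    · rintro _ ⟨p, hp, rfl⟩ _ ⟨q, hq, rfl⟩
      exact hacc' p hp q hq
    · intro y hy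
      obtain ⟨⟨⟨u, v⟩, w⟩, ⟨huv, hw⟩, hsum⟩ := hran (y, G y)
      dsimp only at huv hw
      subst hw
      obtain ⟨hu, hv⟩ := hS _ huv
      have h1 : u + D v = y := congrArg Prod.fst hsum
      have h2 : v + G u = G y := congrArg Prod.snd hsum
      have hGu : G u = G y - v := eq_sub_of_add_eq' h2
      have hBD : IsBDG domG G domD D u := by
        refine ⟨hu, hGu ▸ domD.sub_mem hy.2.1 hv, ?_⟩
        rw [hGu, map_sub, hy.2.2, ← h1, add_sub_cancel_right]
      refine ⟨_, ⟨_, huv, rfl⟩, ?_⟩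
      have hv' : v = G (y - u) := by rw [map_sub, ← h2, add_sub_cancel_right]
      dsimp only
      rw [hγ_id u hBD, hv', hδ_G _ ((boundaryData domG G domD D).sub_mem hy hBD),
        add_sub_cancel]
    · apply Set.Subset.antisymm
      · intro p hp
        exact ⟨(hS p hp).1, (hS p hp).2, p, hp, rfl⟩
      · rintro p ⟨hp1, hp2, r, hr, hrp⟩
        obtain ⟨hr1, hr2⟩ := Prod.mk.inj hrp
        obtain ⟨⟨q, w⟩, ⟨hq, hw⟩, hsum⟩ := hran (p.1 + D p.2, p.2 + G p.1)
        dsimp only at hq hw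
        subst hw
        have h1 : q.1 + D q.2 = p.1 + D p.2 := congrArg Prod.fst hsum
        have h2 : q.2 + G q.1 = p.2 + G p.1 := congrArg Prod.snd hsum
        have h := hacc' r hr q hq
        rw [hr1, hr2, ← green _ hp1 _ (hS q hq).1 _ hp2 _ (hS q hq).2] at h
        have e1 : D p.2 - D q.2 = -(p.1 - q.1) := by
          rw [eq_neg_iff_add_eq_zero, ← sub_eq_zero.mpr h1.symm]; abel
        have e2 : G p.1 - G q.1 = -(p.2 - q.2) := by
          rw [eq_neg_iff_add_eq_zero, ← sub_eq_zero.mpr h2.symm]; abel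
        rw [e1, e2, inner_neg_right, inner_neg_right, real_inner_self_eq_norm_sq,
          real_inner_self_eq_norm_sq] at h
        have n1 : ‖p.1 - q.1‖ ^ 2 = 0 :=
          le_antisymm (by nlinarith [sq_nonneg ‖p.2 - q.2‖]) (sq_nonneg _)
        have n2 : ‖p.2 - q.2‖ ^ 2 = 0 :=
          le_antisymm (by nlinarith [sq_nonneg ‖p.1 - q.1‖]) (sq_nonneg _)
        have hpq : p = q := Prod.ext (sub_eq_zero.mp (by simpa using n1))
          (sub_eq_zero.mp (by simpa using n2))
        exact hpq ▸ hq
  · rintro ⟨M, hMsub, ⟨hacc, hran⟩, rfl⟩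
    constructor
    · rintro ⟨p, p'⟩ ⟨⟨hp1, hp2, hp⟩, hp'⟩ ⟨q, q'⟩ ⟨⟨hq1, hq2, hq⟩, hq'⟩
      dsimp only at *
      subst hp' hq'
      dsimp only
      rw [green _ hp1 _ hq1 _ hp2 _ hq2]
      exact hacc _ hp _ hq
    · rintro ⟨f, g⟩
      obtain ⟨y, hy, hsol⟩ := solve f g
      obtain ⟨⟨z, z'⟩, hz, hzy⟩ := hran y hy
      obtain ⟨u, hu, v, hv, h1, h2, h3, h4⟩ := hsol z (hMsub _ hz).1
      refine ⟨((u, v), (D v, G u)), ⟨⟨hu, hv, ?_⟩, rfl⟩, Prod.ext h1 h2⟩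
      dsimp only at hzy ⊢
      rwa [h3, h4, ← hzy, add_sub_cancel_left]

end Helpers

/-- For a restriction `C` of the block operator `A` to `Dset`, the
following are equivalent: (i) `C` is m-accretive on `H₀ ⊕ H₁`; (ii) there is a contraction
`f : BD(G) → BD(G)` (graph norm) with
`Dset = {(u,v) ∈ dom A : f (½ (u_BD + D v_BD)) = ½ (u_BD - D v_BD)}`; (iii) there is an
m-accretive relation `M` on `BD(G)` with `Dset = {(u,v) ∈ dom A : (u_BD, D v_BD) ∈ M}`. -/
theorem stmt16 {H₀ H₁ : Type*} [NormedAddCommGroup H₀] [InnerProductSpace ℝ H₀]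
    [CompleteSpace H₀] [NormedAddCommGroup H₁] [InnerProductSpace ℝ H₁] [CompleteSpace H₁]
    (domG₀ : Submodule ℝ H₀) (G₀ : H₀ →ₗ[ℝ] H₁)
    (domD₀ : Submodule ℝ H₁) (D₀ : H₁ →ₗ[ℝ] H₀)
    (hdG₀ : Dense (domG₀ : Set H₀)) (hdD₀ : Dense (domD₀ : Set H₁))
    (hclG₀ : IsClosed {p : H₀ × H₁ | p.1 ∈ domG₀ ∧ p.2 = G₀ p.1})
    (hclD₀ : IsClosed {p : H₁ × H₀ | p.1 ∈ domD₀ ∧ p.2 = D₀ p.1})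
    (domG : Submodule ℝ H₀) (G : H₀ →ₗ[ℝ] H₁)
    (domD : Submodule ℝ H₁) (D : H₁ →ₗ[ℝ] H₀)
    (hG : ∀ (u : H₀) (w : H₁), (u ∈ domG ∧ G u = w) ↔ ∀ v ∈ domD₀, ⟪D₀ v, u⟫ = -⟪v, w⟫)
    (hD : ∀ (v : H₁) (w : H₀), (v ∈ domD ∧ D v = w) ↔ ∀ u ∈ domG₀, ⟪G₀ u, v⟫ = -⟪u, w⟫)
    (hGG₀ : ∀ u ∈ domG₀, u ∈ domG ∧ G u = G₀ u)
    (hDD₀ : ∀ v ∈ domD₀, v ∈ domD ∧ D v = D₀ v)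
    (pG : H₀ → H₀) (pD : H₁ → H₁)
    (hpG : ∀ u ∈ domG, IsBDG domG G domD D (pG u) ∧ u - pG u ∈ domG₀)
    (hpD : ∀ v ∈ domD, (pD v ∈ domD ∧ D (pD v) ∈ domG ∧ G (D (pD v)) = pD v) ∧
      v - pD v ∈ domD₀)
    (Dset : Set (H₀ × H₁)) (hDsub : ∀ p ∈ Dset, p.1 ∈ domG ∧ p.2 ∈ domD) :
    (MAccretiveProd {q : (H₀ × H₁) × (H₀ × H₁) | q.1 ∈ Dset ∧ q.2 = (D q.1.2, G q.1.1)} ↔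
      ∃ f : H₀ → H₀,
        (∀ u, IsBDG domG G domD D u → IsBDG domG G domD D (f u)) ∧
        (∀ x y, IsBDG domG G domD D x → IsBDG domG G domD D y →
          Real.sqrt (‖f x - f y‖ ^ 2 + ‖G (f x) - G (f y)‖ ^ 2) ≤
            Real.sqrt (‖x - y‖ ^ 2 + ‖G x - G y‖ ^ 2)) ∧
        Dset = {p : H₀ × H₁ | p.1 ∈ domG ∧ p.2 ∈ domD ∧
          f ((2 : ℝ)⁻¹ • (pG p.1 + D (pD p.2))) = (2 : ℝ)⁻¹ • (pG p.1 - D (pD p.2))}) ∧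
    (MAccretiveProd {q : (H₀ × H₁) × (H₀ × H₁) | q.1 ∈ Dset ∧ q.2 = (D q.1.2, G q.1.1)} ↔
      ∃ M : Set (H₀ × H₀),
        (∀ p ∈ M, IsBDG domG G domD D p.1 ∧ IsBDG domG G domD D p.2) ∧
        MAccretiveBDG domG G domD D M ∧
        Dset = {p : H₀ × H₁ | p.1 ∈ domG ∧ p.2 ∈ domD ∧ (pG p.1, D (pD p.2)) ∈ M}) := by
  have hbd0 {u : H₀} {v : H₁} (hu : u ∈ domG₀) (hv : v ∈ domD) :
      ⟪u, D v⟫ + ⟪v, G u⟫ = 0 := by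
    have h := (hD v (D v)).mp ⟨hv, rfl⟩ u hu
    rw [(hGG₀ u hu).2, real_inner_comm (G₀ u) v, h]
    ring
  have hbd0' {u : H₀} {v : H₁} (hu : u ∈ domG) (hv : v ∈ domD₀) :
      ⟪u, D v⟫ + ⟪v, G u⟫ = 0 := by
    have h := (hG u (G u)).mp ⟨hu, rfl⟩ v hv
    rw [(hDD₀ v hv).2, real_inner_comm, h]
    ring
  have green₁ {u x : H₀} {v : H₁} {y : H₀} (hx : x ∈ domG) (hux : u - x ∈ domG₀)
      (hv : v ∈ domD) (hy : IsBDG domG G domD D y) (hvy : v - G y ∈ domD₀) :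
      ⟪u, D v⟫ + ⟪v, G u⟫ = ⟪x, y⟫ + ⟪G x, G y⟫ := by
    have h1 := hbd0 hux hv
    have h2 := hbd0' hx hvy
    rw [map_sub, inner_sub_left, inner_sub_right] at h1
    rw [map_sub, inner_sub_left, inner_sub_right, hy.2.2] at h2
    rw [real_inner_comm (G y) (G x)]
    linarith
  have pG_eq {u x : H₀} (hu : u ∈ domG) (hx : IsBDG domG G domD D x) (hux : u - x ∈ domG₀) :
      pG u = x := by
    obtain ⟨h1, h2⟩ := hpG u hu
    have hz : IsBDG domG G domD D (pG u - x) := (boundaryData domG G domD D).sub_mem h1 hx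
    have hz0 : pG u - x ∈ domG₀ := by
      have := domG₀.sub_mem hux h2
      rwa [sub_sub_sub_cancel_left] at this
    have h := hbd0 hz0 hz.2.1
    rw [hz.2.2, real_inner_self_eq_norm_sq, real_inner_self_eq_norm_sq] at h
    have n : ‖pG u - x‖ ^ 2 = 0 :=
      le_antisymm (by nlinarith [sq_nonneg ‖G (pG u - x)‖]) (sq_nonneg _)
    exact sub_eq_zero.mp (by simpa using n)
  have hδ {v : H₁} (hv : v ∈ domD) : IsBDG domG G domD D (D (pD v)) := by
    obtain ⟨⟨h1, h2, h3⟩, -⟩ := hpD v hv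
    exact ⟨h2, h3.symm ▸ h1, by rw [h3]⟩
  have hδ0 {v : H₁} (hv : v ∈ domD) : v - G (D (pD v)) ∈ domD₀ := by
    obtain ⟨⟨-, -, h3⟩, h4⟩ := hpD v hv
    rwa [h3]
  have δ_eq {v : H₁} {y : H₀} (hv : v ∈ domD) (hy : IsBDG domG G domD D y)
      (hvy : v - G y ∈ domD₀) : D (pD v) = y := by
    have hz : IsBDG domG G domD D (D (pD v) - y) :=
      (boundaryData domG G domD D).sub_mem (hδ hv) hy
    have hz0 : G (D (pD v) - y) ∈ domD₀ := by
      have := domD₀.sub_mem hvy (hδ0 hv)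
      rwa [sub_sub_sub_cancel_left, ← map_sub] at this
    have h := hbd0' hz.1 hz0
    rw [hz.2.2, real_inner_self_eq_norm_sq, real_inner_self_eq_norm_sq] at h
    have n : ‖D (pD v) - y‖ ^ 2 = 0 :=
      le_antisymm (by nlinarith [sq_nonneg ‖G (D (pD v) - y)‖]) (sq_nonneg _)
    exact sub_eq_zero.mp (by simpa using n)
  have key := mAccretiveProd_iff_exists_mAccretiveBDG (γ := pG) (δ := fun v => D (pD v))
    (fun u hu => (hpG u hu).1) (fun v hv => hδ hv)
    (fun x hx => pG_eq hx.1 hx (by simp)) (fun x hx => δ_eq hx.2.1 hx (by simp))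
    (fun u hu u' hu' v hv v' hv' => by
      rw [← map_sub D, ← map_sub G u, ← map_sub G (pG u), ← map_sub G (D (pD v))]
      refine green₁ (domG.sub_mem (hpG u hu).1.1 (hpG u' hu').1.1) ?_ (domD.sub_mem hv hv')
        ((boundaryData domG G domD D).sub_mem (hδ hv) (hδ hv')) ?_
      · rw [sub_sub_sub_comm]
        exact domG₀.sub_mem (hpG u hu).2 (hpG u' hu').2
      · rw [map_sub, sub_sub_sub_comm]
        exact domD₀.sub_mem (hδ0 hv) (hδ0 hv'))
    (fun f g => by
      obtain ⟨u₀, hu₀, v₀, hv₀, h1, h2⟩ := exists_add_eq_of_isClosed_graph hclG₀ hD f g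
      refine ⟨D (pD v₀), hδ hv₀, fun z hz => ?_⟩
      have hu : u₀ + z ∈ domG := domG.add_mem (hGG₀ u₀ hu₀).1 hz.1
      have hv : v₀ - G z ∈ domD := domD.sub_mem hv₀ hz.2.1
      refine ⟨u₀ + z, hu, v₀ - G z, hv, ?_, ?_, pG_eq hu hz (by simpa using hu₀),
        δ_eq hv ((boundaryData domG G domD D).sub_mem (hδ hv₀) hz) ?_⟩
      · rw [map_sub, hz.2.2, ← h1]; abel
      · rw [map_add, (hGG₀ u₀ hu₀).2, ← h2]; abel
      · rw [map_sub, sub_sub_sub_cancel_right]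
        exact hδ0 hv₀)
    hDsub
  refine ⟨key.trans ⟨?_, ?_⟩, key⟩
  · rintro ⟨M, hMsub, hM, hDset⟩
    obtain ⟨f, hf, hcon, hfM⟩ := hM.exists_contraction hMsub
    refine ⟨f, hf, hcon, hDset.trans (Set.ext fun p => ?_)⟩
    exact and_congr_right fun h1 => and_congr_right fun h2 => hfM _ _ (hpG _ h1).1 (hδ h2)
  · rintro ⟨f, hf, hcon, hDset⟩
    obtain ⟨M, hMsub, hM, hfM⟩ := exists_mAccretiveBDG_of_contraction hf hcon
    refine ⟨M, hMsub, hM, hDset.trans (Set.ext fun p => ?_)⟩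
    exact and_congr_right fun h1 => and_congr_right fun h2 =>
      (hfM _ _ (hpG _ h1).1 (hδ h2)).symm
end

section
/- Let C = {((u,v), A(u,v)) : (u,v) ∈ D} be a restriction of the block operator A whose domain D ⊆ dom(A) is a linear subspace. Then C is m-accretive if and only if there exist a real normed space Y and bounded linear operators S, T : BD(G) → Y (BD(G) with the graph norm of G) such that (a) ran(T − S) ⊆ ran(T + S), (b) T + S is injective, (c) for all x, y ∈ BD(G), (S + T)y = (T − S)x implies ‖y‖_{BD(G)} ≤ ‖x‖_{BD(G)}, and D = {(u, v) ∈ dom(A) : S u_BD = T (D v_BD)}. -/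
/- Setting: `H₀`, `H₁` real Hilbert spaces; `G₀`, `D₀` closed densely defined operators with
domains `domG₀`, `domD₀`; `G = -D₀*` and `D = -G₀*` characterised by `hG`, `hD`, with
`G ⊇ G₀`, `D ⊇ D₀`.  `A` is the block operator `(u, v) ↦ (D v, G u)` with
`dom A = dom G × dom D`.  `pG u = u_BD` and `pD v = v_BD` are the graph-orthogonal
projections onto `BD(G)` and `BD(D)`.  `C` is the restriction of `A` to the linear
subspace `Dsub ⊆ dom A`.  Operators `S, T` from `BD(G)` (with the graph norm
`‖u‖_BD = √(‖u‖² + ‖G u‖²)`) to a normed space `Y` are modelled as linear maps on `H₀`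
which are bounded on `BD(G)` for the graph norm; only their values on `BD(G)` matter. -/

open RealInnerProductSpace

section BoundaryData

variable {H₀ : Type*} {H₁ : Type*} [NormedAddCommGroup H₀] [InnerProductSpace ℝ H₀]
  [NormedAddCommGroup H₁] [InnerProductSpace ℝ H₁]

/-- The submodule `BD(G)`. -/
def bdSubmodule (domG : Submodule ℝ H₀) (G : H₀ →ₗ[ℝ] H₁)
    (domD : Submodule ℝ H₁) (D : H₁ →ₗ[ℝ] H₀) : Submodule ℝ H₀ where
  carrier := {u | IsBDG domG G domD D u}
  zero_mem' := by simp [IsBDG]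
  add_mem' {a b} ha hb :=
    ⟨add_mem ha.1 hb.1, by simpa using add_mem ha.2.1 hb.2.1, by simp [ha.2.2, hb.2.2]⟩
  smul_mem' c a ha :=
    ⟨domG.smul_mem c ha.1, by simpa using domD.smul_mem c ha.2.1, by simp [ha.2.2]⟩

/-- Green's identities on the minimal domains, together with the boundary projections. -/
structure BoundaryData (domG₀ domG : Submodule ℝ H₀) (G : H₀ →ₗ[ℝ] H₁)
    (domD₀ domD : Submodule ℝ H₁) (D : H₁ →ₗ[ℝ] H₀)
    (pG : H₀ → H₀) (pD : H₁ → H₁) : Prop where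
  greenG : ∀ u ∈ domG₀, ∀ v ∈ domD, ⟪G u, v⟫ = -⟪u, D v⟫
  greenD : ∀ v ∈ domD₀, ∀ u ∈ domG, ⟪D v, u⟫ = -⟪v, G u⟫
  leG : domG₀ ≤ domG
  leD : domD₀ ≤ domD
  projG : ∀ u ∈ domG, pG u ∈ bdSubmodule domG G domD D ∧ u - pG u ∈ domG₀
  projD : ∀ v ∈ domD, pD v ∈ bdSubmodule domD D domG G ∧ v - pD v ∈ domD₀

namespace BoundaryData

variable {domG₀ domG : Submodule ℝ H₀} {G : H₀ →ₗ[ℝ] H₁}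
  {domD₀ domD : Submodule ℝ H₁} {D : H₁ →ₗ[ℝ] H₀} {pG : H₀ → H₀} {pD : H₁ → H₁}

theorem symm (h : BoundaryData domG₀ domG G domD₀ domD D pG pD) :
    BoundaryData domD₀ domD D domG₀ domG G pD pG :=
  ⟨h.greenD, h.greenG, h.leD, h.leG, h.projD, h.projG⟩

theorem eq_zero_of_mem (h : BoundaryData domG₀ domG G domD₀ domD D pG pD) {u : H₀}
    (hu : u ∈ bdSubmodule domG G domD D) (hu₀ : u ∈ domG₀) : u = 0 := by
  have h1 := h.greenG u hu₀ (G u) hu.2.1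
  rw [hu.2.2, real_inner_self_eq_norm_sq, real_inner_self_eq_norm_sq] at h1
  have h2 : ‖u‖ ^ 2 = 0 := by nlinarith [sq_nonneg ‖u‖, sq_nonneg ‖G u‖]
  simpa using h2

theorem projG_eq (h : BoundaryData domG₀ domG G domD₀ domD D pG pD) {u x : H₀}
    (hx : x ∈ bdSubmodule domG G domD D) (hux : u - x ∈ domG₀) : pG u = x := by
  have hu : u ∈ domG := by simpa using add_mem (h.leG hux) hx.1
  obtain ⟨h1, h2⟩ := h.projG u hu
  refine sub_eq_zero.1 (h.eq_zero_of_mem (sub_mem h1 hx) ?_)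
  simpa using sub_mem hux h2

theorem projG_add (h : BoundaryData domG₀ domG G domD₀ domD D pG pD) {u w : H₀}
    (hu : u ∈ domG) (hw : w ∈ domG) : pG (u + w) = pG u + pG w := by
  obtain ⟨h1, h2⟩ := h.projG u hu
  obtain ⟨h3, h4⟩ := h.projG w hw
  refine h.projG_eq (add_mem h1 h3) ?_
  rw [add_sub_add_comm]
  exact add_mem h2 h4

theorem projG_smul (h : BoundaryData domG₀ domG G domD₀ domD D pG pD) (c : ℝ) {u : H₀}
    (hu : u ∈ domG) : pG (c • u) = c • pG u := by
  obtain ⟨h1, h2⟩ := h.projG u hu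
  refine h.projG_eq (Submodule.smul_mem _ c h1) ?_
  rw [← smul_sub]
  exact domG₀.smul_mem c h2

theorem projG_sub (h : BoundaryData domG₀ domG G domD₀ domD D pG pD) {u w : H₀}
    (hu : u ∈ domG) (hw : w ∈ domG) : pG (u - w) = pG u - pG w := by
  rw [sub_eq_add_neg, ← neg_one_smul ℝ w, h.projG_add hu (domG.smul_mem _ hw),
    h.projG_smul _ hw, neg_one_smul, sub_eq_add_neg]

theorem projG_of_mem (h : BoundaryData domG₀ domG G domD₀ domD D pG pD) {u : H₀}
    (hu : u ∈ bdSubmodule domG G domD D) : pG u = u :=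
  h.projG_eq hu (by simp)

theorem projG_zero (h : BoundaryData domG₀ domG G domD₀ domD D pG pD) : pG 0 = 0 :=
  h.projG_of_mem (zero_mem _)

/-- `D` maps `BD(D)` into `BD(G)`. -/
theorem map_projD_mem (h : BoundaryData domG₀ domG G domD₀ domD D pG pD) {v : H₁}
    (hv : v ∈ domD) : D (pD v) ∈ bdSubmodule domG G domD D := by
  obtain ⟨⟨h1, h2, h3⟩, -⟩ := h.projD v hv
  exact ⟨h2, by rwa [h3], by rw [h3]⟩

/-- The abstract integration by parts formula in terms of the boundary values. -/
theorem green (h : BoundaryData domG₀ domG G domD₀ domD D pG pD) {u : H₀} {v : H₁}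
    (hu : u ∈ domG) (hv : v ∈ domD) :
    ⟪u, D v⟫ + ⟪v, G u⟫ = ⟪pG u, D (pD v)⟫ + ⟪G (pG u), G (D (pD v))⟫ := by
  obtain ⟨hx, hu₀⟩ := h.projG u hu
  obtain ⟨hy, hv₀⟩ := h.projD v hv
  have h1 := h.greenG _ hu₀ v hv
  have h2 := h.greenD _ hv₀ (pG u) hx.1
  rw [hy.2.2]
  simp only [map_sub, inner_sub_left] at h1 h2
  rw [real_inner_comm (G u) v, real_inner_comm (D (pD v)) (pG u)]
  rw [real_inner_comm (pG u) (D v)] at h2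
  rw [real_inner_comm (G (pG u)) v, real_inner_comm (G (pG u)) (pD v)] at h2
  linarith [real_inner_comm (pG u) (D (pD v))]

/-- The kernel of `1 + A` consists of the pairs `(u, -G u)` with `u ∈ BD(G)`. -/
theorem boundary_of_mem_ker (h : BoundaryData domG₀ domG G domD₀ domD D pG pD) {u : H₀} {v : H₁}
    (hu : u ∈ domG) (hv : v ∈ domD) (h₀ : u + D v = 0) (h₁ : v + G u = 0) :
    pG u = u ∧ D (pD v) = -u := by
  have hGu : G u = -v := eq_neg_of_add_eq_zero_right h₁
  have hDv : D v = -u := eq_neg_of_add_eq_zero_right h₀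
  refine ⟨h.projG_of_mem ⟨hu, ?_, ?_⟩, ?_⟩
  · rw [hGu]; exact neg_mem hv
  · rw [hGu, map_neg, hDv, neg_neg]
  · rw [h.symm.projG_of_mem (u := v) ⟨hv, ?_, ?_⟩, hDv]
    · rw [hDv]; exact neg_mem hu
    · rw [hDv, map_neg, hGu, neg_neg]

end BoundaryData

end BoundaryData

/-- The graph norm of the difference is at most that of the sum iff the graph inner product
is nonnegative. -/
theorem sqrt_graph_sub_le_sqrt_graph_add_iff {E F : Type*} [NormedAddCommGroup E]
    [InnerProductSpace ℝ E] [NormedAddCommGroup F] [InnerProductSpace ℝ F] (G : E →ₗ[ℝ] F)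
    (x w : E) :
    √(‖x - w‖ ^ 2 + ‖G (x - w)‖ ^ 2) ≤ √(‖x + w‖ ^ 2 + ‖G (x + w)‖ ^ 2) ↔
      0 ≤ ⟪x, w⟫ + ⟪G x, G w⟫ := by
  rw [Real.sqrt_le_sqrt_iff (by positivity), map_sub, map_add, norm_sub_sq_real,
    norm_add_sq_real, norm_sub_sq_real, norm_add_sq_real]
  constructor <;> intro h <;> linarith

/-- The resolvent of an accretive linear relation, extended to the whole space. -/
theorem exists_linearMap_add_eq_fst {E F : Type*} [NormedAddCommGroup E]
    [InnerProductSpace ℝ E] [NormedAddCommGroup F] [InnerProductSpace ℝ F] (G : E →ₗ[ℝ] F)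
    (R : Submodule ℝ (E × E)) (hR : ∀ q ∈ R, 0 ≤ ⟪q.1, q.2⟫ + ⟪G q.1, G q.2⟫) :
    ∃ J : E →ₗ[ℝ] E, ∀ q ∈ R, J (q.1 + q.2) = q.1 := by
  let L : R →ₗ[ℝ] E := (LinearMap.fst ℝ E E + LinearMap.snd ℝ E E) ∘ₗ R.subtype
  have hL : LinearMap.ker L = ⊥ := by
    refine LinearMap.ker_eq_bot'.2 fun q hq => ?_
    have h2 : q.1.2 = -q.1.1 := eq_neg_of_add_eq_zero_right hq
    have h1 := hR q.1 q.2
    rw [h2, map_neg, inner_neg_right, inner_neg_right, real_inner_self_eq_norm_sq,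
      real_inner_self_eq_norm_sq] at h1
    have h3 : ‖q.1.1‖ ^ 2 = 0 := by nlinarith [sq_nonneg ‖q.1.1‖, sq_nonneg ‖G q.1.1‖]
    have h4 : q.1.1 = 0 := by simpa using h3
    exact Subtype.ext (Prod.ext h4 (by simp [h2, h4]))
  obtain ⟨K, hK⟩ := L.exists_leftInverse_of_injective hL
  refine ⟨LinearMap.fst ℝ E E ∘ₗ R.subtype ∘ₗ K, fun q hq => ?_⟩
  have h1 : K (L ⟨q, hq⟩) = ⟨q, hq⟩ := LinearMap.congr_fun hK _
  change ((K (L ⟨q, hq⟩) : R) : E × E).1 = q.1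
  rw [h1]

/-- Every pair is the sum of an element of a closed graph and an element of its orthogonal
complement. -/
theorem exists_graph_orthogonal {E F : Type*} [NormedAddCommGroup E]
    [InnerProductSpace ℝ E] [CompleteSpace E] [NormedAddCommGroup F] [InnerProductSpace ℝ F]
    [CompleteSpace F] (dom : Submodule ℝ E) (G : E →ₗ[ℝ] F)
    (hcl : IsClosed {p : E × F | p.1 ∈ dom ∧ p.2 = G p.1}) (f : E) (g : F) :
    ∃ u ∈ dom, ∀ φ ∈ dom, ⟪G φ, g - G u⟫ = -⟪φ, f - u⟫ := by
  let ι : E →ₗ[ℝ] WithLp 2 (E × F) :=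
    (WithLp.linearEquiv 2 ℝ (E × F)).symm.toLinearMap ∘ₗ LinearMap.prod LinearMap.id G
  have hK : IsClosed ((dom.map ι : Submodule ℝ (WithLp 2 (E × F))) : Set (WithLp 2 (E × F))) := by
    convert hcl.preimage (WithLp.prod_continuous_ofLp 2 E F) using 1
    ext z
    constructor
    · rintro ⟨u, hu, rfl⟩
      exact ⟨hu, rfl⟩
    · rintro ⟨h1, h2⟩
      exact ⟨z.fst, h1, (WithLp.ofLp_injective 2) (Prod.ext rfl h2.symm)⟩
  have : CompleteSpace (dom.map ι) := hK.completeSpace_coe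
  obtain ⟨y, ⟨u, hu, rfl⟩, z, hz, hyz⟩ :=
    (dom.map ι).exists_add_mem_mem_orthogonal (WithLp.toLp 2 (f, g))
  refine ⟨u, hu, fun φ hφ => ?_⟩
  have h1 := (Submodule.mem_orthogonal _ _).1 hz (ι φ) ⟨φ, hφ, rfl⟩
  rw [WithLp.prod_inner_apply] at h1
  have hz' : z = WithLp.toLp 2 (f, g) - ι u := by rw [hyz]; abel
  subst hz'
  change ⟪φ, f - u⟫ + ⟪G φ, g - G u⟫ = 0 at h1
  linarith

/-- A linear restriction `C` of the block operator `A` (with domain the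
linear subspace `Dsub`) is m-accretive iff there are a normed space `Y` and bounded linear
operators `S, T : BD(G) → Y` with `ran (T - S) ⊆ ran (T + S)`, `T + S` injective,
`‖(S + T)⁻¹ (T - S)‖ ≤ 1`, and `Dsub = {(u, v) ∈ dom A : S u_BD = T (D v_BD)}`. -/
theorem stmt19 {H₀ : Type u} {H₁ : Type v} [NormedAddCommGroup H₀] [InnerProductSpace ℝ H₀]
    [CompleteSpace H₀] [NormedAddCommGroup H₁] [InnerProductSpace ℝ H₁] [CompleteSpace H₁]
    (domG₀ : Submodule ℝ H₀) (G₀ : H₀ →ₗ[ℝ] H₁)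
    (domD₀ : Submodule ℝ H₁) (D₀ : H₁ →ₗ[ℝ] H₀)
    (hdG₀ : Dense (domG₀ : Set H₀)) (hdD₀ : Dense (domD₀ : Set H₁))
    (hclG₀ : IsClosed {p : H₀ × H₁ | p.1 ∈ domG₀ ∧ p.2 = G₀ p.1})
    (hclD₀ : IsClosed {p : H₁ × H₀ | p.1 ∈ domD₀ ∧ p.2 = D₀ p.1})
    (domG : Submodule ℝ H₀) (G : H₀ →ₗ[ℝ] H₁)
    (domD : Submodule ℝ H₁) (D : H₁ →ₗ[ℝ] H₀)
    (hG : ∀ (u : H₀) (w : H₁), (u ∈ domG ∧ G u = w) ↔ ∀ v ∈ domD₀, ⟪D₀ v, u⟫ = -⟪v, w⟫)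
    (hD : ∀ (v : H₁) (w : H₀), (v ∈ domD ∧ D v = w) ↔ ∀ u ∈ domG₀, ⟪G₀ u, v⟫ = -⟪u, w⟫)
    (hGG₀ : ∀ u ∈ domG₀, u ∈ domG ∧ G u = G₀ u)
    (hDD₀ : ∀ v ∈ domD₀, v ∈ domD ∧ D v = D₀ v)
    (pG : H₀ → H₀) (pD : H₁ → H₁)
    (hpG : ∀ u ∈ domG, IsBDG domG G domD D (pG u) ∧ u - pG u ∈ domG₀)
    (hpD : ∀ v ∈ domD, (pD v ∈ domD ∧ D (pD v) ∈ domG ∧ G (D (pD v)) = pD v) ∧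
      v - pD v ∈ domD₀)
    (Dsub : Submodule ℝ (H₀ × H₁)) (hDsub : ∀ p ∈ Dsub, p.1 ∈ domG ∧ p.2 ∈ domD) :
    MAccretiveProd {q : (H₀ × H₁) × (H₀ × H₁) | q.1 ∈ Dsub ∧ q.2 = (D q.1.2, G q.1.1)} ↔
      ∃ (Y : Type (max u v)) (_ : NormedAddCommGroup Y) (_ : NormedSpace ℝ Y)
        (S T : H₀ →ₗ[ℝ] Y),
        (∃ c : ℝ, ∀ x, IsBDG domG G domD D x →
          ‖S x‖ ≤ c * Real.sqrt (‖x‖ ^ 2 + ‖G x‖ ^ 2)) ∧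
        (∃ c : ℝ, ∀ x, IsBDG domG G domD D x →
          ‖T x‖ ≤ c * Real.sqrt (‖x‖ ^ 2 + ‖G x‖ ^ 2)) ∧
        (∀ x, IsBDG domG G domD D x →
          ∃ y, IsBDG domG G domD D y ∧ T y + S y = T x - S x) ∧
        (∀ x y, IsBDG domG G domD D x → IsBDG domG G domD D y →
          T x + S x = T y + S y → x = y) ∧
        (∀ x y, IsBDG domG G domD D x → IsBDG domG G domD D y →
          S y + T y = T x - S x →
          Real.sqrt (‖y‖ ^ 2 + ‖G y‖ ^ 2) ≤ Real.sqrt (‖x‖ ^ 2 + ‖G x‖ ^ 2)) ∧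
        (Dsub : Set (H₀ × H₁)) =
          {p : H₀ × H₁ | p.1 ∈ domG ∧ p.2 ∈ domD ∧ S (pG p.1) = T (D (pD p.2))} := by
  have h : BoundaryData domG₀ domG G domD₀ domD D pG pD :=
    { greenG := fun u hu v hv => by
        rw [(hGG₀ u hu).2]; exact (hD v (D v)).1 ⟨hv, rfl⟩ u hu
      greenD := fun v hv u hu => by
        rw [(hDD₀ v hv).2]; exact (hG u (G u)).1 ⟨hu, rfl⟩ v hv
      leG := fun u hu => (hGG₀ u hu).1
      leD := fun v hv => (hDD₀ v hv).1
      projG := hpG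
      projD := hpD }
  constructor
  · rintro ⟨hacc, hmax⟩
    have hpos : ∀ p ∈ Dsub,
        0 ≤ ⟪pG p.1, D (pD p.2)⟫ + ⟪G (pG p.1), G (D (pD p.2))⟫ := fun p hp => by
      have := hacc (p, (D p.2, G p.1)) ⟨hp, rfl⟩ 0
        ⟨zero_mem _, Prod.ext (map_zero D).symm (map_zero G).symm⟩
      rw [← h.green (hDsub p hp).1 (hDsub p hp).2]
      simpa using this
    have hres : ∀ u ∈ domG, ∀ v ∈ domD, ∃ p ∈ Dsub,
        (u - p.1) + D (v - p.2) = 0 ∧ (v - p.2) + G (u - p.1) = 0 := fun u hu v hv => by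
      obtain ⟨⟨p, a⟩, ⟨hp, ha⟩, hq⟩ := hmax (u + D v, v + G u)
      obtain rfl : a = (D p.2, G p.1) := ha
      have h1 : p.1 + D p.2 = u + D v := congrArg Prod.fst hq
      have h2 : p.2 + G p.1 = v + G u := congrArg Prod.snd hq
      refine ⟨p, hp, ?_, ?_⟩
      · rw [map_sub, sub_add_sub_comm, h1, sub_self]
      · rw [map_sub, sub_add_sub_comm, h2, sub_self]
    let R : Submodule ℝ (H₀ × H₀) :=
      { carrier := {q | ∃ p ∈ Dsub, pG p.1 = q.1 ∧ D (pD p.2) = q.2}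
        zero_mem' := ⟨0, zero_mem _, by simp [h.projG_zero], by simp [h.symm.projG_zero]⟩
        add_mem' := by
          rintro a b ⟨p, hp, hp1, hp2⟩ ⟨q, hq, hq1, hq2⟩
          refine ⟨p + q, add_mem hp hq, ?_, ?_⟩
          · simp [h.projG_add (hDsub p hp).1 (hDsub q hq).1, hp1, hq1]
          · simp [h.symm.projG_add (hDsub p hp).2 (hDsub q hq).2, hp2, hq2]
        smul_mem' := by
          rintro c a ⟨p, hp, hp1, hp2⟩
          refine ⟨c • p, Dsub.smul_mem c hp, ?_, ?_⟩
          · simp [h.projG_smul c (hDsub p hp).1, hp1]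
          · simp [h.symm.projG_smul c (hDsub p hp).2, hp2] }
    have hRpos : ∀ q ∈ R, 0 ≤ ⟪q.1, q.2⟫ + ⟪G q.1, G q.2⟫ := by
      rintro q ⟨p, hp, hp1, hp2⟩
      rw [← hp1, ← hp2]
      exact hpos p hp
    obtain ⟨J, hJ⟩ := exists_linearMap_add_eq_fst G R hRpos
    have hRmem : ∀ x, IsBDG domG G domD D x → (J x, x - J x) ∈ R ∧ IsBDG domG G domD D (J x) := by
      intro x hx
      obtain ⟨p, hp, h1, h2⟩ := hres x hx.1 0 (zero_mem _)
      have hpd := hDsub p hp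
      obtain ⟨h3, h4⟩ := h.boundary_of_mem_ker (sub_mem hx.1 hpd.1)
        (sub_mem (zero_mem _) hpd.2) h1 h2
      rw [h.projG_sub hx.1 hpd.1, h.projG_of_mem hx] at h3
      rw [h.symm.projG_sub (zero_mem _) hpd.2, h.symm.projG_zero, map_sub, map_zero, ← h3] at h4
      have h5 : D (pD p.2) = x - pG p.1 := neg_injective (by simpa using h4)
      have hR : (pG p.1, x - pG p.1) ∈ R := ⟨p, hp, rfl, h5⟩
      have h6 : J x = pG p.1 := by simpa using hJ _ hR
      rw [h6]
      exact ⟨hR, (h.projG _ hpd.1).1⟩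
    let ι : H₀ →ₗ[ℝ] WithLp 2 (H₀ × H₁) :=
      (WithLp.linearEquiv 2 ℝ (H₀ × H₁)).symm.toLinearMap ∘ₗ LinearMap.prod LinearMap.id G
    have hι : ∀ x, ‖ι x‖ = √(‖x‖ ^ 2 + ‖G x‖ ^ 2) := fun x => WithLp.prod_norm_eq_of_L2 _
    have hinj : Function.Injective ι := fun x y hxy =>
      congrArg (fun z : WithLp 2 (H₀ × H₁) => z.fst) hxy
    have hST : ∀ x, ι (J x) + ι (x - J x) = ι x := fun x => by rw [← map_add]; simp
    have hcontr : ∀ x, IsBDG domG G domD D x →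
        √(‖J x - (x - J x)‖ ^ 2 + ‖G (J x - (x - J x))‖ ^ 2) ≤ √(‖x‖ ^ 2 + ‖G x‖ ^ 2) := by
      intro x hx
      have := (sqrt_graph_sub_le_sqrt_graph_add_iff G _ _).2 (hRpos _ (hRmem x hx).1)
      simpa only [add_sub_cancel] using this
    have hcontr' : ∀ x, IsBDG domG G domD D x → ‖ι (J x) - ι (x - J x)‖ ≤ ‖ι x‖ := by
      intro x hx
      rw [← map_sub, hι, hι]
      exact hcontr x hx
    refine ⟨WithLp 2 (H₀ × H₁), inferInstance, inferInstance, ι ∘ₗ (LinearMap.id - J), ι ∘ₗ J,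
      ⟨1, fun x hx => ?_⟩, ⟨1, fun x hx => ?_⟩, fun x hx => ?_, fun x y hx hy hxy => ?_,
      fun x y hx hy hxy => ?_, ?_⟩
    · rw [one_mul, ← hι]
      change ‖ι (x - J x)‖ ≤ ‖ι x‖
      have h1 : (2 : ℝ) • ι (x - J x) = ι x - (ι (J x) - ι (x - J x)) := by
        rw [← hST x, two_smul]; abel
      have h2 := norm_sub_le (ι x) (ι (J x) - ι (x - J x))
      rw [← h1, norm_smul, Real.norm_ofNat] at h2
      linarith [hcontr' x hx]
    · rw [one_mul, ← hι]
      change ‖ι (J x)‖ ≤ ‖ι x‖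
      have h1 : (2 : ℝ) • ι (J x) = ι x + (ι (J x) - ι (x - J x)) := by
        rw [← hST x, two_smul]; abel
      have h2 := norm_add_le (ι x) (ι (J x) - ι (x - J x))
      rw [← h1, norm_smul, Real.norm_ofNat] at h2
      linarith [hcontr' x hx]
    · have hJx : J x ∈ bdSubmodule domG G domD D := (hRmem x hx).2
      have hx' : x ∈ bdSubmodule domG G domD D := hx
      refine ⟨J x - (x - J x), sub_mem hJx (sub_mem hx' hJx), ?_⟩
      exact (hST _).trans (map_sub ι _ _)
    · exact hinj ((hST x).symm.trans (hxy.trans (hST y)))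
    · have h1 : ι y = ι (J x - (x - J x)) := by
        rw [map_sub, ← hST y, add_comm]
        exact hxy
      rw [hinj h1]
      exact hcontr x hx
    · ext ⟨u, v⟩
      constructor
      · intro hp
        obtain ⟨hu, hv⟩ := hDsub _ hp
        refine ⟨hu, hv, congrArg ι ?_⟩
        have h1 : J (pG u + D (pD v)) = pG u := hJ (pG u, D (pD v)) ⟨_, hp, rfl, rfl⟩
        rw [map_add] at h1
        change pG u - J (pG u) = J (D (pD v))
        exact sub_eq_iff_eq_add'.2 h1.symm
      · rintro ⟨hu, hv, huv⟩
        change u ∈ domG at hu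
        change v ∈ domD at hv
        have h1 : pG u - J (pG u) = J (D (pD v)) := hinj huv
        have h2 : J (pG u + D (pD v)) = pG u := by rw [map_add, ← h1]; abel
        have hx : pG u ∈ bdSubmodule domG G domD D := (h.projG u hu).1
        have h3 := (hRmem _ (add_mem hx (h.map_projD_mem hv))).1
        rw [h2, add_sub_cancel_left] at h3
        obtain ⟨p, hp, h4, h5⟩ := hres u hu v hv
        have hpd := hDsub p hp
        have h6 : (pG (u - p.1), D (pD (v - p.2))) ∈ R := by
          rw [h.projG_sub hu hpd.1, h.symm.projG_sub hv hpd.2, map_sub]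
          exact sub_mem h3 (show (pG p.1, D (pD p.2)) ∈ R from ⟨p, hp, rfl, rfl⟩)
        obtain ⟨h7, h8⟩ := h.boundary_of_mem_ker (sub_mem hu hpd.1) (sub_mem hv hpd.2) h4 h5
        have h9 := hJ _ h6
        rw [h7, h8, add_neg_cancel, map_zero] at h9
        change 0 = u - p.1 at h9
        rw [← h9, map_zero, add_zero] at h5
        have h10 : p = (u, v) := Prod.ext (sub_eq_zero.1 h9.symm).symm (sub_eq_zero.1 h5).symm
        exact h10 ▸ hp
  · rintro ⟨Y, _, _, S, T, -, -, hran, -, hle, hDs⟩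
    have hmem : ∀ u v, (u, v) ∈ Dsub ↔ u ∈ domG ∧ v ∈ domD ∧ S (pG u) = T (D (pD v)) :=
      fun u v => Set.ext_iff.1 hDs (u, v)
    refine ⟨?_, ?_⟩
    · rintro ⟨p, a⟩ ⟨hp, ha⟩ ⟨q, b⟩ ⟨hq, hb⟩
      obtain rfl : a = (D p.2, G p.1) := ha
      obtain rfl : b = (D q.2, G q.1) := hb
      change 0 ≤ ⟪p.1 - q.1, D p.2 - D q.2⟫ + ⟪p.2 - q.2, G p.1 - G q.1⟫
      obtain ⟨hu, hv, huv⟩ := (hmem (p.1 - q.1) (p.2 - q.2)).1 (sub_mem hp hq)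
      rw [← map_sub, ← map_sub, h.green hu hv, ← sqrt_graph_sub_le_sqrt_graph_add_iff]
      have hx := (h.projG _ hu).1
      have hw := h.map_projD_mem hv
      refine hle _ _ (add_mem hx hw) (sub_mem hx hw) ?_
      simp only [map_add, map_sub, huv]
      abel
    · rintro ⟨f, g⟩
      obtain ⟨u, hu, hug⟩ := exists_graph_orthogonal domG₀ G₀ hclG₀ f g
      obtain ⟨hv, hDv⟩ := (hD (g - G₀ u) (f - u)).2 hug
      rw [← (hGG₀ u hu).2] at hv hDv
      have hw := h.map_projD_mem hv
      obtain ⟨y, hy, hyw⟩ := hran _ hw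
      set w := D (pD (g - G u))
      have hy' : y ∈ bdSubmodule domG G domD D := hy
      have hz : (2⁻¹ : ℝ) • (w + y) ∈ bdSubmodule domG G domD D :=
        Submodule.smul_mem _ _ (add_mem hw hy')
      have hzw : T ((2⁻¹ : ℝ) • (w + y)) + S ((2⁻¹ : ℝ) • (w + y)) = T w := by
        have h1 : T (w + y) + S (w + y) = (2 : ℝ) • T w := by
          rw [map_add, map_add, add_add_add_comm, hyw, two_smul]; abel
        rw [map_smul, map_smul, ← smul_add, h1, smul_smul]
        norm_num
      set z := (2⁻¹ : ℝ) • (w + y)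
      have hGz : G z ∈ bdSubmodule domD D domG G :=
        ⟨hz.2.1, by rw [hz.2.2]; exact hz.1, by rw [hz.2.2]⟩
      have h1 : pG (u + z) = z := h.projG_eq hz (by simpa using hu)
      have h2 : D (pD (g - G u - G z)) = w - z := by
        rw [h.symm.projG_sub hv hz.2.1, h.symm.projG_of_mem hGz, map_sub, hz.2.2]
      refine ⟨((u + z, g - G u - G z), (D (g - G u - G z), G (u + z))), ⟨?_, rfl⟩, ?_⟩
      · refine (hmem _ _).2 ⟨add_mem (h.leG hu) hz.1, sub_mem hv hz.2.1, ?_⟩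
        rw [h1, h2, map_sub, ← hzw]
        abel
      · refine Prod.ext ?_ ?_
        · change u + z + D (g - G u - G z) = f
          rw [map_sub, hDv, hz.2.2]
          abel
        · change g - G u - G z + G (u + z) = g
          rw [map_add]
          abel
end
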